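/- Assume N ≥ 5, hypotheses (V) and (K) with s > 2N/(N+4), Q = 0, and that f is continuous with f(t) = 0 for t < 0. Suppose there exist q₁, q₂ > 2 such that (f_{q₁,q₂}) and (R''_{q₁,q₂}) hold, and that either f satisfies (f₁): ∃θ > 2 with 0 ≤ θF(t) ≤ f(t)t for all t ≥ 0, together with (f₂): ∃t₀ > 0 with F(t₀) > 0; or K(|·|) ∈ L¹(ℝ^N) and f satisfies (f₃): ∃θ > 2 and ∃t₀ > 0 with 0 < θF(t) ≤ f(t)t for all t ≥ t₀. Then the functional I : H²_{V,r}(ℝ^N) → ℝ satisfies the Palais–Smale condition: every sequence {u_n} ⊂ H²_{V,r} such that {I(u_n)} is bounded and I'(u_n) → 0 in the dual space of H²_{V,r} has a subsequence converging strongly in H²_{V,r}. -/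

import Mathlib

open MeasureTheory Filter Topology Set ENNReal

noncomputable section

/-- Euclidean space `ℝ^N`. -/
abbrev E (N : ℕ) := EuclideanSpace ℝ (Fin N)

/-- The (classical) Laplacian of a function `φ : ℝ^N → ℝ`. -/
def lapl {N : ℕ} (φ : E N → ℝ) (x : E N) : ℝ :=
  ∑ i : Fin N, fderiv ℝ (fun y => fderiv ℝ φ y (EuclideanSpace.single i 1)) x
    (EuclideanSpace.single i 1)

/-- A function is radial if it depends only on the norm. -/
def IsRadial {N : ℕ} (u : E N → ℝ) : Prop := ∀ x y : E N, ‖x‖ = ‖y‖ → u x = u y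

/-- The critical exponent `2** = 2N/(N-4)` as an element of `ℝ≥0∞`. -/
def twoSS (N : ℕ) : ℝ≥0∞ := (2 * N : ℝ≥0∞) / ((N : ℝ≥0∞) - 4)

/-- `u ∈ D^{2,2}(ℝ^N)` with (distributional) Laplacian `w`: `u` lies in `L^{2**}`,
`w ∈ L²`, and `u` is the limit in `L^{2**}` of smooth compactly supported functions whose
Laplacians converge to `w` in `L²` (i.e. `u` lies in the closure of `C_c^∞` for the norm
`‖Δ·‖_{L²}`, with `Δu = w`). -/
def MemD22 (N : ℕ) (u w : E N → ℝ) : Prop :=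
  MemLp u (twoSS N) volume ∧ MemLp w 2 volume ∧
  ∃ φ : ℕ → E N → ℝ,
    (∀ n, ContDiff ℝ (⊤ : ℕ∞) (φ n) ∧ HasCompactSupport (φ n)) ∧
    Tendsto (fun n => eLpNorm (fun x => φ n x - u x) (twoSS N) volume) atTop (𝓝 0) ∧
    Tendsto (fun n => eLpNorm (fun x => lapl (φ n) x - w x) 2 volume) atTop (𝓝 0)

/-- `u ∈ H²_V(ℝ^N)` (with Laplacian `w`). -/
def MemH2V {N : ℕ} (V : ℝ → ℝ≥0∞) (u w : E N → ℝ) : Prop :=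
  MemD22 N u w ∧ (∫⁻ x : E N, V ‖x‖ * ENNReal.ofReal ((u x) ^ 2)) < ⊤

/-- `u ∈ H²_{V,r}(ℝ^N)`: member of `H²_V` which is radial. -/
def MemH2Vr {N : ℕ} (V : ℝ → ℝ≥0∞) (u w : E N → ℝ) : Prop :=
  MemH2V V u w ∧ IsRadial u

/-- The norm of `H²_V`: `‖u‖ = (∫ |Δu|² + V(|x|)u²)^{1/2}` (here `w = Δu`). -/
def H2norm {N : ℕ} (V : ℝ → ℝ≥0∞) (u w : E N → ℝ) : ℝ :=
  (((∫⁻ x : E N, ENNReal.ofReal ((w x) ^ 2)) +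
    ∫⁻ x : E N, V ‖x‖ * ENNReal.ofReal ((u x) ^ 2)).toReal) ^ (1/2 : ℝ)

/-- Hypothesis (V): `V : (0,∞) → [0,∞]` measurable and locally integrable on `(0,∞)`. -/
def HypV (V : ℝ → ℝ≥0∞) : Prop :=
  Measurable V ∧ ∀ a b : ℝ, 0 < a → (∫⁻ r in Set.Icc a b, V r) < ⊤

/-- Hypothesis (K): `K : (0,∞) → (0,∞)` measurable with `K ∈ L^s_loc((0,∞))`. -/
def HypK (K : ℝ → ℝ) (s : ℝ) : Prop :=
  (∀ r : ℝ, 0 < r → 0 < K r) ∧ Measurable K ∧ 1 < s ∧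
  ∀ a b : ℝ, 0 < a → IntegrableOn (fun r => K r ^ s) (Set.Icc a b) volume

/-- The quantity `S₀(q,R)`. -/
def S0 (N : ℕ) (V : ℝ → ℝ≥0∞) (K : ℝ → ℝ) (q R : ℝ) : ℝ≥0∞ :=
  ⨆ p : {p : (E N → ℝ) × (E N → ℝ) // MemH2Vr V p.1 p.2 ∧ H2norm V p.1 p.2 = 1},
    ∫⁻ x in Metric.ball (0 : E N) R, ENNReal.ofReal (K ‖x‖ * |p.1.1 x| ^ q)

/-- The quantity `S_∞(q,R)`. -/
def Sinf (N : ℕ) (V : ℝ → ℝ≥0∞) (K : ℝ → ℝ) (q R : ℝ) : ℝ≥0∞ :=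
  ⨆ p : {p : (E N → ℝ) × (E N → ℝ) // MemH2Vr V p.1 p.2 ∧ H2norm V p.1 p.2 = 1},
    ∫⁻ x in (Metric.ball (0 : E N) R)ᶜ, ENNReal.ofReal (K ‖x‖ * |p.1.1 x| ^ q)

/-- The quantity `R₀(q,R)`. -/
def R0 (N : ℕ) (V : ℝ → ℝ≥0∞) (K : ℝ → ℝ) (q R : ℝ) : ℝ≥0∞ :=
  ⨆ p : {p : ((E N → ℝ) × (E N → ℝ)) × ((E N → ℝ) × (E N → ℝ)) //
      MemH2Vr V p.1.1 p.1.2 ∧ MemH2Vr V p.2.1 p.2.2 ∧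
      H2norm V p.1.1 p.1.2 = 1 ∧ H2norm V p.2.1 p.2.2 = 1},
    ∫⁻ x in Metric.ball (0 : E N) R,
      ENNReal.ofReal (K ‖x‖ * |p.1.1.1 x| ^ (q - 1) * |p.1.2.1 x|)

/-- The quantity `R_∞(q,R)`. -/
def Rinf (N : ℕ) (V : ℝ → ℝ≥0∞) (K : ℝ → ℝ) (q R : ℝ) : ℝ≥0∞ :=
  ⨆ p : {p : ((E N → ℝ) × (E N → ℝ)) × ((E N → ℝ) × (E N → ℝ)) //
      MemH2Vr V p.1.1 p.1.2 ∧ MemH2Vr V p.2.1 p.2.2 ∧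
      H2norm V p.1.1 p.1.2 = 1 ∧ H2norm V p.2.1 p.2.2 = 1},
    ∫⁻ x in (Metric.ball (0 : E N) R)ᶜ,
      ENNReal.ofReal (K ‖x‖ * |p.1.1.1 x| ^ (q - 1) * |p.1.2.1 x|)

/-- The weighted measure `K(|x|)dx`. -/
def Kmeas (N : ℕ) (K : ℝ → ℝ) : Measure (E N) :=
  volume.withDensity (fun x => ENNReal.ofReal (K ‖x‖))

/-- Membership in the sum space `L^{q₁}_K + L^{q₂}_K`. -/
def MemSum (N : ℕ) (K : ℝ → ℝ) (q1 q2 : ℝ) (u : E N → ℝ) : Prop :=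
  ∃ u1 u2 : E N → ℝ, u = u1 + u2 ∧ MemLp u1 (ENNReal.ofReal q1) (Kmeas N K) ∧
    MemLp u2 (ENNReal.ofReal q2) (Kmeas N K)

/-- The norm of the sum space `L^{q₁}_K + L^{q₂}_K`. -/
def sumNorm (N : ℕ) (K : ℝ → ℝ) (q1 q2 : ℝ) (u : E N → ℝ) : ℝ≥0∞ :=
  ⨅ p : {p : (E N → ℝ) × (E N → ℝ) // u = p.1 + p.2},
    max (eLpNorm p.1.1 (ENNReal.ofReal q1) (Kmeas N K))
        (eLpNorm p.1.2 (ENNReal.ofReal q2) (Kmeas N K))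

/-- `σ_N`, the (N-1)-dimensional measure of the unit sphere, i.e. `N·ω_N`. -/
def sigmaN (N : ℕ) : ℝ := N * (volume (Metric.ball (0 : E N) 1)).toReal

end

noncomputable section

/-- `F(t) = ∫₀ᵗ f(s) ds`. -/
def Fint (f : ℝ → ℝ) (t : ℝ) : ℝ := ∫ s in (0:ℝ)..t, f s

/-- Hypothesis `(f_{q₁,q₂})`: `|f(t)| ≤ M min{t^{q₁-1}, t^{q₂-1}}` for all `t ≥ 0`. -/
def Hypf (f : ℝ → ℝ) (q1 q2 : ℝ) : Prop :=
  ∃ M > (0:ℝ), ∀ t : ℝ, 0 ≤ t → |f t| ≤ M * min (t ^ (q1 - 1)) (t ^ (q2 - 1))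

/-- Hypothesis `(Q)`: `Q ≥ 0` on `(0,∞)`, measurable, and `h ↦ ∫ Q(|x|)h dx` is a
continuous linear functional on `H²_V`. -/
def HypQ (N : ℕ) (V : ℝ → ℝ≥0∞) (Q : ℝ → ℝ) : Prop :=
  Measurable Q ∧ (∀ r : ℝ, 0 < r → 0 ≤ Q r) ∧
  ∃ L ≥ (0:ℝ), ∀ h z : E N → ℝ, MemH2V V h z →
    Integrable (fun x => Q ‖x‖ * h x) ∧ |∫ x, Q ‖x‖ * h x| ≤ L * H2norm V h z

/-- The weak-formulation identity, tested against `h ∈ H²_V` (with Laplacian `z`):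
`∫ Δu Δh + ∫ V(|x|)u h = ∫ K(|x|)f(u)h + ∫ Q(|x|)h`, all integrals being finite. -/
def EulerEq (N : ℕ) (V : ℝ → ℝ≥0∞) (K Q f : ℝ → ℝ) (u w h z : E N → ℝ) : Prop :=
  Integrable (fun x => w x * z x) ∧
  Integrable (fun x => (V ‖x‖).toReal * u x * h x) ∧
  Integrable (fun x => K ‖x‖ * f (u x) * h x) ∧
  Integrable (fun x => Q ‖x‖ * h x) ∧
  (∫ x, w x * z x) + (∫ x, (V ‖x‖).toReal * u x * h x)
    = (∫ x, K ‖x‖ * f (u x) * h x) + ∫ x, Q ‖x‖ * h x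

/-- `u` (with Laplacian `w`) is a radial weak solution of
`Δ²u + V(|x|)u = K(|x|)f(u) + Q(|x|)` in `ℝ^N`. -/
def IsWeakSolution (N : ℕ) (V : ℝ → ℝ≥0∞) (K Q f : ℝ → ℝ) (u w : E N → ℝ) : Prop :=
  MemH2Vr V u w ∧ ∀ h z : E N → ℝ, MemH2V V h z → EulerEq N V K Q f u w h z

/-- Condition `(R''_{q₁,q₂})`. -/
def Rcond (N : ℕ) (V : ℝ → ℝ≥0∞) (K : ℝ → ℝ) (q1 q2 : ℝ) : Prop :=
  Tendsto (fun R => R0 N V K q1 R) (𝓝[>] (0:ℝ)) (𝓝 0) ∧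
  Tendsto (fun R => Rinf N V K q2 R) atTop (𝓝 0)

/-- The Euler functional `I(u) = ½‖u‖² - ∫ K(|x|)F(u) dx - ∫ Q(|x|)u dx`. -/
def EulerI (N : ℕ) (V : ℝ → ℝ≥0∞) (K Q f : ℝ → ℝ) (u w : E N → ℝ) : ℝ :=
  (1/2) * H2norm V u w ^ (2:ℕ) - (∫ x, K ‖x‖ * Fint f (u x)) - ∫ x, Q ‖x‖ * u x

end

open MeasureTheory Filter Topology Set ENNReal

/-- Partial derivative. -/
noncomputable def pd {N : ℕ} (i : Fin N) (φ : E N → ℝ) (x : E N) : ℝ :=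
  fderiv ℝ φ x (EuclideanSpace.single i 1)

lemma lapl_eq_pd {N : ℕ} (φ : E N → ℝ) (x : E N) : lapl φ x = ∑ i, pd i (pd i φ) x := rfl

lemma pd_contDiff {N : ℕ} (i : Fin N) {φ : E N → ℝ} (h : ContDiff ℝ (⊤ : ℕ∞) φ) :
    ContDiff ℝ (⊤ : ℕ∞) (pd i φ) := by
  have := h.fderiv_right (m := (⊤ : ℕ∞)) (by simp)
  exact this.clm_apply contDiff_const

lemma pd_supp {N : ℕ} (i : Fin N) {φ : E N → ℝ} (h : HasCompactSupport φ) :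
    HasCompactSupport (pd i φ) := h.fderiv_apply ℝ _

lemma cs_int {N : ℕ} {f g : E N → ℝ} (hf : Continuous f) (hg : Continuous g)
    (hfs : HasCompactSupport f) : Integrable (fun x => f x * g x) :=
  (hf.mul hg).integrable_of_hasCompactSupport hfs.mul_right

lemma pd_ibp {N : ℕ} (i : Fin N) {f g : E N → ℝ} (hf : ContDiff ℝ (⊤ : ℕ∞) f)
    (hg : ContDiff ℝ (⊤ : ℕ∞) g) (hfs : HasCompactSupport f) :
    ∫ x, f x * pd i g x = - ∫ x, pd i f x * g x := by
  have hfd := hf.differentiable (by simp)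
  have hgd := hg.differentiable (by simp)
  exact integral_mul_fderiv_eq_neg_fderiv_mul_of_integrable
    (cs_int (pd_contDiff i hf).continuous hg.continuous (pd_supp i hfs))
    (cs_int hf.continuous (pd_contDiff i hg).continuous hfs)
    (cs_int hf.continuous hg.continuous hfs) (fun x _ => hfd x) (fun x _ => hgd x)

lemma pd_apply_fderiv {N : ℕ} (i j : Fin N) {φ : E N → ℝ} (h : ContDiff ℝ (⊤ : ℕ∞) φ) (x : E N) :
    pd i (pd j φ) x = fderiv ℝ (fderiv ℝ φ) x (EuclideanSpace.single i 1)
      (EuclideanSpace.single j 1) := by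
  have h1 : DifferentiableAt ℝ (fderiv ℝ φ) x :=
    (h.fderiv_right (m := (⊤ : ℕ∞)) (by simp)).differentiable (by simp) x
  unfold pd
  rw [fderiv_clm_apply h1 (differentiableAt_const _)]
  simp

lemma pd_comm {N : ℕ} (i j : Fin N) {φ : E N → ℝ} (h : ContDiff ℝ (⊤ : ℕ∞) φ) :
    pd i (pd j φ) = pd j (pd i φ) := by
  funext x
  rw [pd_apply_fderiv i j h, pd_apply_fderiv j i h]
  have : IsSymmSndFDerivAt ℝ φ x := (h.contDiffAt).isSymmSndFDerivAt
    (by simp only [minSmoothness_of_isRCLikeNormedField]; 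
        have : ((2:ℕ∞):WithTop ℕ∞) ≤ ((⊤:ℕ∞):WithTop ℕ∞) := WithTop.coe_le_coe.2 le_top
        exact this)
  exact this _ _

lemma pd_sq {N : ℕ} (i j : Fin N) {φ : E N → ℝ} (h : ContDiff ℝ (⊤ : ℕ∞) φ)
    (hs : HasCompactSupport φ) :
    ∫ x, pd i (pd j φ) x * pd i (pd j φ) x = ∫ x, pd j (pd j φ) x * pd i (pd i φ) x := by
  have hj := pd_contDiff j h
  have hi := pd_contDiff i h
  rw [pd_ibp i (pd_contDiff i hj) hj (pd_supp i (pd_supp j hs))]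
  have e1 : pd i (pd i (pd j φ)) = pd j (pd i (pd i φ)) := by
    rw [pd_comm i j h, pd_comm i j hi]
  rw [e1]
  have := pd_ibp j hj (pd_contDiff i hi) (pd_supp j hs)
  rw [← neg_eq_iff_eq_neg] at this
  rw [← this]
  congr 1
  exact integral_congr_ae (Eventually.of_forall fun x => by simp [mul_comm])

lemma lapl_contDiff {N : ℕ} {φ : E N → ℝ} (h : ContDiff ℝ (⊤ : ℕ∞) φ) :
    ContDiff ℝ (⊤ : ℕ∞) (lapl φ) := by
  have : lapl φ = fun x => ∑ i, pd i (pd i φ) x := rfl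
  rw [this]
  exact ContDiff.sum fun i _ => pd_contDiff i (pd_contDiff i h)

lemma pd_sq_le {N : ℕ} (i j : Fin N) {φ : E N → ℝ} (h : ContDiff ℝ (⊤ : ℕ∞) φ)
    (hs : HasCompactSupport φ) :
    ∫ x, pd i (pd j φ) x * pd i (pd j φ) x ≤ ∫ x, lapl φ x * lapl φ x := by
  have e : ∫ x, lapl φ x * lapl φ x = ∑ a, ∑ b, ∫ x, pd a (pd b φ) x * pd a (pd b φ) x := by
    rw [Finset.sum_congr rfl fun a _ => Finset.sum_congr rfl fun b _ => pd_sq a b h hs]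
    have : ∀ x, lapl φ x * lapl φ x = ∑ a, ∑ b, pd b (pd b φ) x * pd a (pd a φ) x := by
      intro x
      rw [lapl_eq_pd, Finset.sum_mul_sum]
      exact Finset.sum_congr rfl fun a _ => Finset.sum_congr rfl fun b _ => mul_comm _ _
    simp_rw [this]
    have hI : ∀ a b : Fin N, Integrable (fun x => pd b (pd b φ) x * pd a (pd a φ) x) := fun a b =>
      cs_int (pd_contDiff b (pd_contDiff b h)).continuous
        (pd_contDiff a (pd_contDiff a h)).continuous (pd_supp b (pd_supp b hs))
    rw [integral_finsetSum _ fun a _ => integrable_finsetSum _ fun b _ => hI a b]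
    exact Finset.sum_congr rfl fun a _ => integral_finsetSum _ fun b _ => hI a b
  rw [e]
  have nn : ∀ a b : Fin N, 0 ≤ ∫ x, pd a (pd b φ) x * pd a (pd b φ) x := fun a b =>
    integral_nonneg fun x => mul_self_nonneg _
  refine le_trans ?_ (Finset.single_le_sum (f := fun a => ∑ b, ∫ x, pd a (pd b φ) x * pd a (pd b φ) x)
    (fun a _ => Finset.sum_nonneg fun b _ => nn a b) (Finset.mem_univ i))
  exact Finset.single_le_sum (f := fun b => ∫ x, pd i (pd b φ) x * pd i (pd b φ) x)
    (fun b _ => nn i b) (Finset.mem_univ j)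

lemma lapl_supp {N : ℕ} {φ : E N → ℝ} (hs : HasCompactSupport φ) :
    HasCompactSupport (lapl φ) := by
  have : ∀ x, x ∉ tsupport φ → lapl φ x = 0 := by
    intro x hx
    rw [lapl_eq_pd]
    refine Finset.sum_eq_zero fun i _ => ?_
    have h1 : tsupport (pd i (pd i φ)) ⊆ tsupport φ :=
      (tsupport_fderiv_apply_subset ℝ _).trans (tsupport_fderiv_apply_subset ℝ _)
    exact image_eq_zero_of_notMem_tsupport fun h => hx (h1 h)
  exact HasCompactSupport.intro hs this

lemma eLpNorm_two_le {N : ℕ} {f g : E N → ℝ} (hf : Continuous f) (hg : Continuous g)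
    (hfs : HasCompactSupport f) (hgs : HasCompactSupport g)
    (h : ∫ x, f x * f x ≤ ∫ x, g x * g x) : eLpNorm f 2 volume ≤ eLpNorm g 2 volume := by
  have key : ∀ f : E N → ℝ, Continuous f → HasCompactSupport f →
      eLpNorm f 2 volume = (ENNReal.ofReal (∫ x, f x * f x)) ^ (1 / 2 : ℝ) := by
    intro f hf hfs
    rw [eLpNorm_eq_lintegral_rpow_enorm_toReal (by simp) (by simp)]
    rw [ofReal_integral_eq_lintegral_ofReal (cs_int hf hf hfs)
      (Eventually.of_forall fun x => mul_self_nonneg _)]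
    simp only [ENNReal.toReal_ofNat]
    congr 1
    refine lintegral_congr fun x => ?_
    rw [← ofReal_norm, ENNReal.ofReal_rpow_of_nonneg (norm_nonneg _) (by norm_num)]
    congr 1
    rw [Real.norm_eq_abs]
    norm_num [← pow_two]
  rw [key f hf hfs, key g hg hgs]
  gcongr

lemma clm_norm_le {N : ℕ} {F : Type*} [NormedAddCommGroup F] [NormedSpace ℝ F] (A : E N →L[ℝ] F) :
    ‖A‖ ≤ ∑ i, ‖A (EuclideanSpace.single i 1)‖ := by
  refine A.opNorm_le_bound (Finset.sum_nonneg fun i _ => norm_nonneg _) fun x => ?_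
  have hx : x = ∑ i, x i • (EuclideanSpace.single i (1:ℝ) : E N) := by
    have := (EuclideanSpace.basisFun (Fin N) ℝ).sum_repr x
    simpa using this.symm
  conv_lhs => rw [hx]
  rw [map_sum, Finset.sum_mul]
  refine (norm_sum_le _ _).trans (Finset.sum_le_sum fun i _ => ?_)
  rw [map_smul, norm_smul, mul_comm]
  gcongr
  exact PiLp.norm_apply_le x i

lemma eLpNorm_sum_bd {N : ℕ} {F : Type*} [NormedAddCommGroup F] (f : E N → F)
    (g : Fin N → E N → ℝ) (hfg : ∀ x, ‖f x‖ ≤ ∑ i, ‖g i x‖)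
    (hg : ∀ i, AEStronglyMeasurable (g i) volume) (p B : ℝ≥0∞) (hp : 1 ≤ p)
    (hB : ∀ i, eLpNorm (g i) p volume ≤ B) :
    eLpNorm f p volume ≤ (N : ℝ≥0∞) * B := by
  have h1 : eLpNorm f p volume
      ≤ eLpNorm (∑ i : Fin N, fun x => ‖g i x‖) p volume := by
    refine eLpNorm_mono_real fun x => ?_
    simpa only [Finset.sum_apply] using hfg x
  refine h1.trans ?_
  refine (eLpNorm_sum_le (fun i _ => (hg i).norm) hp).trans ?_
  refine (Finset.sum_le_sum fun i _ => (eLpNorm_norm (g i)).le.trans (hB i)).trans ?_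
  rw [Finset.sum_const, Finset.card_univ, Fintype.card_fin, nsmul_eq_mul]

lemma hess_le {N : ℕ} {φ : E N → ℝ} (h : ContDiff ℝ (⊤ : ℕ∞) φ)
    (hs : HasCompactSupport φ) (j : Fin N) :
    eLpNorm (fderiv ℝ (pd j φ)) 2 volume ≤ (N : ℝ≥0∞) * eLpNorm (lapl φ) 2 volume := by
  have hpt : ∀ x, ‖fderiv ℝ (pd j φ) x‖ ≤ ∑ i : Fin N, ‖pd i (pd j φ) x‖ :=
    fun x => clm_norm_le _
  refine eLpNorm_sum_bd _ (fun i => pd i (pd j φ)) hpt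
    (fun i => (pd_contDiff i (pd_contDiff j h)).continuous.aestronglyMeasurable) _ _
    (by norm_num) fun i => ?_
  exact eLpNorm_two_le (pd_contDiff i (pd_contDiff j h)).continuous
      (lapl_contDiff h).continuous (pd_supp i (pd_supp j hs)) (lapl_supp hs) (pd_sq_le i j h hs)

/-- `2* = 2N/(N-2)`. -/
noncomputable def pstar (N : ℕ) : NNReal := Real.toNNReal (2 * N / (N - 2))

lemma twoSS_eq {N : ℕ} (hN : 5 ≤ N) : twoSS N = (Real.toNNReal (2 * N / (N - 4)) : NNReal) := by
  have h5 : (5:ℝ) ≤ N := by exact_mod_cast hN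
  unfold twoSS
  change _ = ENNReal.ofReal _
  rw [ENNReal.ofReal_div_of_pos (by linarith), ENNReal.ofReal_sub _ (by norm_num)]
  simp [ENNReal.ofReal_mul]

lemma sobolev_smooth {N : ℕ} (hN : 5 ≤ N) : ∃ C : NNReal, ∀ φ : E N → ℝ,
    ContDiff ℝ (⊤ : ℕ∞) φ → HasCompactSupport φ →
    eLpNorm (fderiv ℝ φ) (pstar N) volume ≤ C * eLpNorm (lapl φ) 2 volume ∧
    eLpNorm φ (twoSS N) volume ≤ C * eLpNorm (lapl φ) 2 volume := by
  have h5 : (5:ℝ) ≤ N := by exact_mod_cast hN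
  set C1 := SNormLESNormFDerivOfEqConst ℝ (volume : Measure (E N)) (2 : NNReal)
  set C2 := SNormLESNormFDerivOfEqConst ℝ (volume : Measure (E N)) (pstar N)
  have hfr : Module.finrank ℝ (E N) = N := by simp
  have hp : ((pstar N : NNReal) : ℝ) = 2 * N / (N - 2) :=
    Real.coe_toNNReal _ (div_nonneg (by linarith) (by linarith))
  refine ⟨max (C1 * (N * N)) (C2 * (C1 * (N * N))), fun φ h hs => ?_⟩
  have hp1 : 1 ≤ pstar N := by
    rw [← NNReal.coe_le_coe, hp, NNReal.coe_one, le_div_iff₀ (by linarith)]; linarith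
  have A : eLpNorm (fderiv ℝ φ) (pstar N) volume
      ≤ (C1 * (N * N) : NNReal) * eLpNorm (lapl φ) 2 volume := by
    have : ∀ j : Fin N, eLpNorm (pd j φ) (pstar N) volume
        ≤ C1 * (N * eLpNorm (lapl φ) 2 volume) := fun j => by
      have := eLpNorm_le_eLpNorm_fderiv_of_eq (volume : Measure (E N)) (u := pd j φ)
        ((pd_contDiff j h).of_le (by exact_mod_cast le_top)) (pd_supp j hs) (p := 2)
        (p' := pstar N) (by norm_num)
        (by rw [hfr]; omega) (by
          rw [hp, hfr]; push_cast; field_simp)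
      exact this.trans (mul_le_mul' le_rfl (hess_le h hs j))
    refine (eLpNorm_sum_bd _ (fun i => pd i φ) (fun x => clm_norm_le _)
      (fun i => (pd_contDiff i h).continuous.aestronglyMeasurable) _ _
      (by exact_mod_cast hp1) this).trans ?_
    push_cast
    exact le_of_eq (by ring)
  have B : eLpNorm φ (twoSS N) volume
      ≤ (C2 * (C1 * (N * N)) : NNReal) * eLpNorm (lapl φ) 2 volume := by
    rw [twoSS_eq hN]
    have := eLpNorm_le_eLpNorm_fderiv_of_eq (volume : Measure (E N)) (u := φ)
      (h.of_le (by exact_mod_cast le_top)) hs (p := pstar N)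
      (p' := Real.toNNReal (2 * N / (N - 4))) (by
        rw [← NNReal.coe_le_coe, hp, NNReal.coe_one, le_div_iff₀ (by linarith)]; linarith)
      (by rw [hfr]; omega) (by
        rw [NNReal.coe_inv, hp, hfr, Real.coe_toNNReal _ (div_nonneg (by linarith) (by linarith))]
        have : (N:ℝ) - 2 ≠ 0 := by linarith
        have : (N:ℝ) - 4 ≠ 0 := by linarith
        field_simp; ring)
    refine this.trans ?_
    rw [ENNReal.coe_mul, mul_assoc]
    gcongr
  constructor
  · refine A.trans ?_
    gcongr
    exact le_max_left _ _
  · refine B.trans ?_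
    gcongr
    exact le_max_right _ _

open MeasureTheory Filter Topology Set ENNReal

lemma pd_smul_sub {N : ℕ} (i : Fin N) {φ ψ : E N → ℝ} (c d : ℝ) (h : ContDiff ℝ (⊤ : ℕ∞) φ)
    (h' : ContDiff ℝ (⊤ : ℕ∞) ψ) :
    pd i (fun x => c * φ x + d * ψ x) = fun x => c * pd i φ x + d * pd i ψ x := by
  funext x
  have h1 := (h.differentiable (by simp)) x
  have h2 := (h'.differentiable (by simp)) x
  unfold pd
  rw [fderiv_fun_add (h1.const_mul c) (h2.const_mul d), fderiv_const_mul h1, fderiv_const_mul h2]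
  simp

lemma lapl_lin {N : ℕ} {φ ψ : E N → ℝ} (c d : ℝ) (h : ContDiff ℝ (⊤ : ℕ∞) φ)
    (h' : ContDiff ℝ (⊤ : ℕ∞) ψ) (x : E N) :
    lapl (fun x => c * φ x + d * ψ x) x = c * lapl φ x + d * lapl ψ x := by
  simp only [lapl_eq_pd]
  rw [Finset.mul_sum, Finset.mul_sum, ← Finset.sum_add_distrib]
  refine Finset.sum_congr rfl fun i _ => ?_
  rw [pd_smul_sub i c d h h', pd_smul_sub i c d (pd_contDiff i h) (pd_contDiff i h')]

lemma one_le_twoSS {N : ℕ} (hN : 5 ≤ N) : 1 ≤ twoSS N := by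
  have h5 : (5:ℝ) ≤ N := by exact_mod_cast hN
  rw [twoSS_eq hN]
  have : (1:NNReal) ≤ Real.toNNReal (2 * N / (N - 4)) := by
    rw [← NNReal.coe_le_coe, Real.coe_toNNReal _ (div_nonneg (by linarith) (by linarith)),
      NNReal.coe_one, le_div_iff₀ (by linarith)]
    linarith
  exact_mod_cast this

lemma eLpNorm_lin_tendsto {N : ℕ} {p : ℝ≥0∞} (hp : 1 ≤ p) {a a' : ℕ → E N → ℝ} {b b' : E N → ℝ}
    (c d : ℝ)
    (hm : ∀ n, AEStronglyMeasurable (fun x => a n x - b x) volume)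
    (hm' : ∀ n, AEStronglyMeasurable (fun x => a' n x - b' x) volume)
    (h : Tendsto (fun n => eLpNorm (fun x => a n x - b x) p volume) atTop (𝓝 0))
    (h' : Tendsto (fun n => eLpNorm (fun x => a' n x - b' x) p volume) atTop (𝓝 0)) :
    Tendsto (fun n => eLpNorm (fun x => (c * a n x + d * a' n x) - (c * b x + d * b' x)) p volume)
      atTop (𝓝 0) := by
  have h1 : Tendsto (fun n => ‖c‖ₑ * eLpNorm (fun x => a n x - b x) p volume
      + ‖d‖ₑ * eLpNorm (fun x => a' n x - b' x) p volume) atTop (𝓝 0) := by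
    have := (ENNReal.Tendsto.const_mul h (Or.inr (enorm_ne_top (x := c)))).add
      (ENNReal.Tendsto.const_mul h' (Or.inr (enorm_ne_top (x := d))))
    simpa using this
  refine tendsto_of_tendsto_of_tendsto_of_le_of_le tendsto_const_nhds h1 (fun n => zero_le)
    fun n => ?_
  have e : (fun x => (c * a n x + d * a' n x) - (c * b x + d * b' x))
      = (c • fun x => a n x - b x) + (d • fun x => a' n x - b' x) := by
    funext x; simp; ring
  rw [e]
  refine (eLpNorm_add_le ((hm n).const_smul c) ((hm' n).const_smul d) hp).trans ?_
  rw [eLpNorm_const_smul, eLpNorm_const_smul]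

lemma MemD22.lin {N : ℕ} (hN : 5 ≤ N) {u w u' w' : E N → ℝ} (c d : ℝ) (h : MemD22 N u w)
    (h' : MemD22 N u' w') :
    MemD22 N (fun x => c * u x + d * u' x) (fun x => c * w x + d * w' x) := by
  obtain ⟨hu, hw, φ, hφ, h1, h2⟩ := h
  obtain ⟨hu', hw', φ', hφ', h1', h2'⟩ := h'
  refine ⟨(hu.const_mul c).add (hu'.const_mul d), (hw.const_mul c).add (hw'.const_mul d),
    fun n x => c * φ n x + d * φ' n x, fun n => ⟨?_, ?_⟩, ?_, ?_⟩
  · exact (contDiff_const.mul (hφ n).1).add (contDiff_const.mul (hφ' n).1)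
  · exact ((hφ n).2.mul_left (f := fun _ => c)).add ((hφ' n).2.mul_left (f := fun _ => d))
  · exact eLpNorm_lin_tendsto (one_le_twoSS hN) c d
      (fun n => (hφ n).1.continuous.aestronglyMeasurable.sub hu.1)
      (fun n => (hφ' n).1.continuous.aestronglyMeasurable.sub hu'.1) h1 h1'
  · have := eLpNorm_lin_tendsto (p := 2) (by norm_num) c d
      (fun n => (lapl_contDiff (hφ n).1).continuous.aestronglyMeasurable.sub hw.1)
      (fun n => (lapl_contDiff (hφ' n).1).continuous.aestronglyMeasurable.sub hw'.1) h2 h2'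
    refine this.congr fun n => ?_
    congr 1
    funext x
    rw [lapl_lin c d (hφ n).1 (hφ' n).1]

lemma sobolev_D22 {N : ℕ} (hN : 5 ≤ N) : ∃ C : NNReal, ∀ u w : E N → ℝ, MemD22 N u w →
    eLpNorm u (twoSS N) volume ≤ C * eLpNorm w 2 volume := by
  obtain ⟨C, hC⟩ := sobolev_smooth hN
  refine ⟨C, fun u w ⟨hu, hw, φ, hφ, h1, h2⟩ => ?_⟩
  have key : ∀ n, eLpNorm u (twoSS N) volume ≤ eLpNorm (fun x => φ n x - u x) (twoSS N) volume
      + C * (eLpNorm (fun x => lapl (φ n) x - w x) 2 volume + eLpNorm w 2 volume) := by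
    intro n
    have e1 : u = φ n - fun x => φ n x - u x := by funext x; simp
    have e2 : lapl (φ n) = (fun x => lapl (φ n) x - w x) + w := by funext x; simp
    have m1 := (hφ n).1.continuous.aestronglyMeasurable (μ := volume)
    have m2 := (lapl_contDiff (hφ n).1).continuous.aestronglyMeasurable (μ := volume)
    calc eLpNorm u (twoSS N) volume = eLpNorm (φ n - fun x => φ n x - u x) (twoSS N) volume := by
          rw [← e1]
      _ ≤ eLpNorm (φ n) (twoSS N) volume + eLpNorm (fun x => φ n x - u x) (twoSS N) volume :=
          eLpNorm_sub_le m1 (m1.sub hu.1) (one_le_twoSS hN)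
      _ = eLpNorm (fun x => φ n x - u x) (twoSS N) volume + eLpNorm (φ n) (twoSS N) volume :=
          add_comm _ _
      _ ≤ _ := by
          gcongr
          refine (hC _ (hφ n).1 (hφ n).2).2.trans ?_
          gcongr
          conv_lhs => rw [e2]
          exact eLpNorm_add_le (m2.sub hw.1) hw.1 (by norm_num)
  have lim := h1.add (ENNReal.Tendsto.const_mul (a := (C:ℝ≥0∞)) (h2.add_const (eLpNorm w 2 volume))
    (Or.inr coe_ne_top))
  rw [zero_add, zero_add] at lim
  exact ge_of_tendsto' lim key

/-- Squared norm, `ℝ≥0∞`-valued. -/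
noncomputable def QQ {N : ℕ} (V : ℝ → ℝ≥0∞) (u w : E N → ℝ) : ℝ≥0∞ :=
  (∫⁻ x : E N, ENNReal.ofReal ((w x) ^ 2)) + ∫⁻ x : E N, V ‖x‖ * ENNReal.ofReal ((u x) ^ 2)

lemma H2norm_eq {N : ℕ} (V : ℝ → ℝ≥0∞) (u w : E N → ℝ) :
    H2norm V u w = Real.sqrt (QQ V u w).toReal := by
  rw [Real.sqrt_eq_rpow]; rfl

lemma H2norm_nonneg {N : ℕ} (V : ℝ → ℝ≥0∞) (u w : E N → ℝ) : 0 ≤ H2norm V u w := by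
  rw [H2norm_eq]; exact Real.sqrt_nonneg _

lemma H2norm_sq {N : ℕ} (V : ℝ → ℝ≥0∞) (u w : E N → ℝ) :
    H2norm V u w ^ 2 = (QQ V u w).toReal := by
  rw [H2norm_eq, Real.sq_sqrt toReal_nonneg]

lemma lint_sq {N : ℕ} (w : E N → ℝ) :
    ∫⁻ x : E N, ENNReal.ofReal ((w x) ^ 2) = eLpNorm w 2 volume ^ 2 := by
  rw [eLpNorm_eq_lintegral_rpow_enorm_toReal (by simp) (by simp)]
  rw [← ENNReal.rpow_natCast, ← ENNReal.rpow_mul]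
  simp only [ENNReal.toReal_ofNat, Nat.cast_ofNat, one_div, ne_eq, OfNat.ofNat_ne_zero,
    not_false_eq_true, inv_mul_cancel₀, rpow_one]
  refine lintegral_congr fun x => ?_
  rw [← ofReal_norm, ENNReal.ofReal_rpow_of_nonneg (norm_nonneg _) (by norm_num)]
  congr 1
  rw [Real.norm_eq_abs]
  norm_num

lemma QQ_lt_top {N : ℕ} {V : ℝ → ℝ≥0∞} {u w : E N → ℝ} (h : MemH2Vr V u w) : QQ V u w < ⊤ := by
  refine ENNReal.add_lt_top.2 ⟨?_, h.1.2⟩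
  rw [lint_sq]
  exact ENNReal.pow_lt_top h.1.1.2.1.2

lemma eLpNorm_w_le {N : ℕ} {V : ℝ → ℝ≥0∞} {u w : E N → ℝ} (h : MemH2Vr V u w) :
    eLpNorm w 2 volume ≤ ENNReal.ofReal (H2norm V u w) := by
  have h1 : eLpNorm w 2 volume ^ 2 ≤ QQ V u w := by
    rw [← lint_sq]; exact le_self_add
  have h2 : ENNReal.ofReal (H2norm V u w) ^ 2 = QQ V u w := by
    rw [← ENNReal.ofReal_pow (H2norm_nonneg _ _ _), H2norm_sq, ENNReal.ofReal_toReal (QQ_lt_top h).ne]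
  rw [← h2] at h1
  exact (ENNReal.pow_le_pow_left_iff two_ne_zero).1 h1

lemma IsRadial.lin {N : ℕ} {u u' : E N → ℝ} (c d : ℝ) (h : IsRadial u) (h' : IsRadial u') :
    IsRadial (fun x => c * u x + d * u' x) := fun x y hxy => by
  simp only [h x y hxy, h' x y hxy]

lemma MemH2Vr.lin {N : ℕ} (hN : 5 ≤ N) {V : ℝ → ℝ≥0∞} (hV : Measurable V)
    {u w u' w' : E N → ℝ} (c d : ℝ) (h : MemH2Vr V u w)
    (h' : MemH2Vr V u' w') :
    MemH2Vr V (fun x => c * u x + d * u' x) (fun x => c * w x + d * w' x) := by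
  refine ⟨⟨h.1.1.lin hN c d h'.1.1, ?_⟩, h.2.lin c d h'.2⟩
  have key : ∀ x : E N, V ‖x‖ * ENNReal.ofReal ((c * u x + d * u' x) ^ 2)
      ≤ ENNReal.ofReal (2 * c^2) * (V ‖x‖ * ENNReal.ofReal ((u x)^2))
        + ENNReal.ofReal (2 * d^2) * (V ‖x‖ * ENNReal.ofReal ((u' x)^2)) := by
    intro x
    calc V ‖x‖ * ENNReal.ofReal ((c * u x + d * u' x) ^ 2)
        ≤ V ‖x‖ * ENNReal.ofReal (2 * c^2 * u x ^2 + 2 * d^2 * u' x^2) := by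
          gcongr
          nlinarith [sq_nonneg (c * u x - d * u' x)]
      _ = _ := by
          rw [ENNReal.ofReal_add (by positivity) (by positivity),
            ENNReal.ofReal_mul (p := 2 * c^2) (by positivity),
            ENNReal.ofReal_mul (p := 2 * d^2) (by positivity)]
          ring
  have hm : ∀ {v z : E N → ℝ}, MemH2Vr V v z → AEMeasurable
      (fun x : E N => V ‖x‖ * ENNReal.ofReal ((v x)^2)) volume := fun {v z} hv =>
    (hV.comp measurable_norm).aemeasurable.mul
      (ENNReal.measurable_ofReal.comp_aemeasurable (hv.1.1.1.1.aemeasurable.pow_const 2))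
  refine (lintegral_mono key).trans_lt ?_
  rw [lintegral_add_left' ((hm h).const_mul _), lintegral_const_mul'' _ (hm h),
    lintegral_const_mul'' _ (hm h')]
  exact ENNReal.add_lt_top.2 ⟨ENNReal.mul_lt_top ofReal_lt_top h.1.2,
    ENNReal.mul_lt_top ofReal_lt_top h'.1.2⟩

lemma MemH2Vr.sub {N : ℕ} (hN : 5 ≤ N) {V : ℝ → ℝ≥0∞} (hV : Measurable V)
    {u w u' w' : E N → ℝ} (h : MemH2Vr V u w) (h' : MemH2Vr V u' w') :
    MemH2Vr V (fun x => u x - u' x) (fun x => w x - w' x) := by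
  have := h.lin hN hV 1 (-1) h'
  simpa [← sub_eq_add_neg] using this

lemma MemH2Vr.smul {N : ℕ} (hN : 5 ≤ N) {V : ℝ → ℝ≥0∞} (hV : Measurable V)
    {u w : E N → ℝ} (c : ℝ) (h : MemH2Vr V u w) :
    MemH2Vr V (fun x => c * u x) (fun x => c * w x) := by
  have := h.lin hN hV c 0 h
  simpa using this

lemma QQ_smul {N : ℕ} {V : ℝ → ℝ≥0∞} (hV : Measurable V) {u w : E N → ℝ} (c : ℝ)
    (h : MemH2Vr V u w) :
    QQ V (fun x => c * u x) (fun x => c * w x) = ENNReal.ofReal (c^2) * QQ V u w := by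
  unfold QQ
  rw [mul_add]
  congr 1
  · rw [← lintegral_const_mul' _ _ ofReal_ne_top]
    refine lintegral_congr fun x => ?_
    rw [mul_pow, ENNReal.ofReal_mul (by positivity)]
  · rw [← lintegral_const_mul' _ _ ofReal_ne_top]
    refine lintegral_congr fun x => ?_
    rw [mul_pow, ENNReal.ofReal_mul (by positivity)]
    ring

lemma H2norm_smul {N : ℕ} {V : ℝ → ℝ≥0∞} (hV : Measurable V) {u w : E N → ℝ} {c : ℝ} (hc : 0 ≤ c)
    (h : MemH2Vr V u w) :
    H2norm V (fun x => c * u x) (fun x => c * w x) = c * H2norm V u w := by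
  rw [H2norm_eq, H2norm_eq, QQ_smul hV c h, ENNReal.toReal_mul, ENNReal.toReal_ofReal (by positivity),
    Real.sqrt_mul (by positivity), Real.sqrt_sq hc]

open MeasureTheory Filter Topology Set ENNReal

/-- surface measure -/
noncomputable abbrev sph (N : ℕ) : Measure (Metric.sphere (0 : E N) 1) :=
  (volume : Measure (E N)).toSphere

/-- the polar map -/
def polm {N : ℕ} (p : Metric.sphere (0 : E N) 1 × Ioi (0:ℝ)) : E N := p.2.1 • p.1.1

lemma polm_mp (N : ℕ) (hN : 5 ≤ N) : MeasurePreserving (polm (N := N))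
    ((sph N).prod (Measure.volumeIoiPow (N - 1))) (volume : Measure (E N)) := by
  have h := (volume : Measure (E N)).measurePreserving_homeomorphUnitSphereProd
  have hfr : Module.finrank ℝ (E N) = N := by simp
  rw [hfr] at h
  have h2 := h.symm (homeomorphUnitSphereProd (E N)).toMeasurableEquiv
  have : Nonempty (Fin N) := ⟨⟨0, by omega⟩⟩
  have h3 : MeasurePreserving (Subtype.val : ({0}ᶜ : Set (E N)) → E N)
      (Measure.comap (↑) (volume : Measure (E N))) volume := by
    refine ⟨measurable_subtype_coe, ?_⟩
    rw [map_comap_subtype_coe (measurableSet_singleton _).compl, restrict_compl_singleton]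
  exact h3.comp h2

lemma polar {N : ℕ} (hN : 5 ≤ N) (F : E N → ℝ≥0∞) (hF : AEMeasurable F volume) :
    ∫⁻ x, F x = ∫⁻ θ, (∫⁻ r in Ioi (0:ℝ), ENNReal.ofReal (r^(N-1)) * F (r • θ.1)) ∂(sph N) ∧
    ∫⁻ x, F x = ∫⁻ r in Ioi (0:ℝ), ENNReal.ofReal (r^(N-1)) * ∫⁻ θ, F (r • θ.1) ∂(sph N) := by
  have mp := polm_mp N hN
  have hF' : AEMeasurable (fun p => F (polm p)) ((sph N).prod (Measure.volumeIoiPow (N - 1))) :=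
    hF.comp_quasiMeasurePreserving mp.quasiMeasurePreserving
  have e0 : ∫⁻ x, F x = ∫⁻ p, F (polm p) ∂((sph N).prod (Measure.volumeIoiPow (N - 1))) := by
    rw [← mp.map_eq] at hF ⊢
    rw [lintegral_map' hF mp.measurable.aemeasurable]
  have hdm : Measurable fun r : Ioi (0:ℝ) => ENNReal.ofReal (r.1 ^ (N-1)) := by fun_prop
  have conv : ∀ G : ℝ → ℝ≥0∞, ∫⁻ r : Ioi (0:ℝ), G r.1 ∂(Measure.volumeIoiPow (N - 1))
      = ∫⁻ r in Ioi (0:ℝ), ENNReal.ofReal (r^(N-1)) * G r := by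
    intro G
    rw [Measure.volumeIoiPow, lintegral_withDensity_eq_lintegral_mul_non_measurable _ hdm
      (Eventually.of_forall fun r => ofReal_lt_top)]
    exact lintegral_subtype_comap measurableSet_Ioi
      (fun r : ℝ => ENNReal.ofReal (r^(N-1)) * G r)
  constructor
  · rw [e0, lintegral_prod _ hF']
    exact lintegral_congr fun θ => conv fun r => F (r • θ.1)
  · rw [e0, lintegral_prod_symm _ hF']
    exact conv fun r => ∫⁻ θ, F (r • θ.1) ∂(sph N)

/-- spherical integral -/
noncomputable def sav {N : ℕ} (φ : E N → ℝ) (r : ℝ) : ℝ := ∫ θ, φ (r • θ.1) ∂(sph N)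

lemma sav_int {N : ℕ} {φ : E N → ℝ} (h : Continuous φ) (r : ℝ) :
    Integrable (fun θ : Metric.sphere (0 : E N) 1 => φ (r • θ.1)) (sph N) := by
  have : CompactSpace (Metric.sphere (0 : E N) 1) := isCompact_iff_compactSpace.1 (isCompact_sphere _ _)
  have hc : Continuous (fun θ : Metric.sphere (0 : E N) 1 => φ (r • θ.1)) := by fun_prop
  exact hc.integrable_of_hasCompactSupport (HasCompactSupport.of_compactSpace _)

lemma sav_meas {N : ℕ} {φ : E N → ℝ} (h : Continuous φ) : Measurable (sav φ) := by
  have : StronglyMeasurable (Function.uncurry fun (r : ℝ) (θ : Metric.sphere (0 : E N) 1) =>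
      φ (r • θ.1)) := by
    apply Continuous.stronglyMeasurable
    fun_prop
  exact (this.integral_prod_right (ν := sph N)).measurable

lemma ray_est {N : ℕ} {φ : E N → ℝ} (h : ContDiff ℝ (⊤ : ℕ∞) φ) {a b : ℝ} (hab : a ≤ b) (θ : E N)
    (hθ : ‖θ‖ = 1) :
    ‖φ (b • θ) - φ (a • θ)‖ₑ ≤ ∫⁻ r in Ioc a b, ‖fderiv ℝ φ (r • θ)‖ₑ := by
  have hd : ∀ r : ℝ, HasDerivAt (fun r : ℝ => φ (r • θ)) (fderiv ℝ φ (r • θ) θ) r := by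
    intro r
    have h1 := (h.differentiable (by simp) (r • θ)).hasFDerivAt
    have h2 : HasDerivAt (fun r : ℝ => r • θ) θ r := by
      simpa using (hasDerivAt_id r).smul_const θ
    exact h1.comp_hasDerivAt r h2
  have hc : Continuous fun r : ℝ => fderiv ℝ φ (r • θ) θ := by
    have := (h.fderiv_right (m := (⊤ : ℕ∞)) (by simp)).continuous
    fun_prop
  have := intervalIntegral.integral_eq_sub_of_hasDerivAt (a := a) (b := b) (fun r _ => hd r)
    (hc.intervalIntegrable _ _)
  rw [← this, intervalIntegral.integral_of_le hab]
  refine (enorm_integral_le_lintegral_enorm _).trans (lintegral_mono fun r => ?_)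
  rw [← ofReal_norm, ← ofReal_norm]
  refine ENNReal.ofReal_le_ofReal ?_
  simpa [hθ] using (fderiv ℝ φ (r • θ)).le_opNorm θ

/-- annulus -/
def ann (N : ℕ) (a b : ℝ) : Set (E N) := {x | a < ‖x‖ ∧ ‖x‖ ≤ b}

lemma ann_meas (N : ℕ) (a b : ℝ) : MeasurableSet (ann N a b) :=
  (measurableSet_lt measurable_const measurable_norm).inter
    (measurableSet_le measurable_norm measurable_const)

lemma sav_est {N : ℕ} (hN : 5 ≤ N) {φ : E N → ℝ} (h : ContDiff ℝ (⊤ : ℕ∞) φ) {a b : ℝ}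
    (ha : 0 < a) (hab : a ≤ b) :
    ‖sav φ b - sav φ a‖ₑ ≤ ENNReal.ofReal ((a^(N-1))⁻¹) * ∫⁻ x in ann N a b, ‖fderiv ℝ φ x‖ₑ := by
  have hcont := (h.fderiv_right (m := (⊤ : ℕ∞)) (by simp)).continuous
  unfold sav
  rw [← integral_sub (sav_int h.continuous b) (sav_int h.continuous a)]
  refine (enorm_integral_le_lintegral_enorm _).trans ?_
  have hm : Measurable ((ann N a b).indicator fun x => ‖fderiv ℝ φ x‖ₑ) :=
    Measurable.indicator (by fun_prop) (ann_meas N a b)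
  rw [← lintegral_indicator (ann_meas N a b), (polar hN _ hm.aemeasurable).1]
  rw [← lintegral_const_mul' _ _ ofReal_ne_top]
  refine lintegral_mono fun θ => ?_
  have hθ : ‖θ.1‖ = 1 := by simp
  refine (ray_est h hab θ.1 hθ).trans ?_
  rw [← lintegral_const_mul' _ _ ofReal_ne_top]
  calc ∫⁻ r in Ioc a b, ‖fderiv ℝ φ (r • θ.1)‖ₑ
      ≤ ∫⁻ r in Ioc a b, ENNReal.ofReal ((a^(N-1))⁻¹) * (ENNReal.ofReal (r^(N-1)) *
        (ann N a b).indicator (fun x => ‖fderiv ℝ φ x‖ₑ) (r • θ.1)) := by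
        refine setLIntegral_mono' measurableSet_Ioc fun r hr => ?_
        have hr0 : 0 < r := ha.trans hr.1
        have hmem : r • θ.1 ∈ ann N a b := by
          simp [ann, norm_smul, hθ, abs_of_pos hr0]; exact hr
        rw [indicator_of_mem hmem, ← mul_assoc, ← ENNReal.ofReal_mul (by positivity)]
        refine le_mul_of_one_le_left' ?_
        rw [ENNReal.one_le_ofReal, inv_mul_eq_div, one_le_div (by positivity)]
        exact pow_le_pow_left₀ ha.le hr.1.le _
    _ ≤ _ := lintegral_mono_set fun r hr => ha.trans hr.1

lemma ann_vol {N : ℕ} (hN : 5 ≤ N) {a b : ℝ} (ha : 0 < a) (hab : a ≤ b) :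
    volume (ann N a b) = ENNReal.ofReal (b^N - a^N) * volume (Metric.ball (0:E N) 1) := by
  have hfr : Module.finrank ℝ (E N) = N := by simp
  have : Nonempty (Fin N) := ⟨⟨0, by omega⟩⟩
  have e : ann N a b = Metric.closedBall 0 b \ Metric.closedBall 0 a := by
    ext x; simp [ann]; tauto
  rw [e, measure_sdiff (Metric.closedBall_subset_closedBall hab)
    measurableSet_closedBall.nullMeasurableSet measure_closedBall_lt_top.ne,
    Measure.addHaar_closedBall _ _ (ha.le.trans hab), Measure.addHaar_closedBall _ _ ha.le, hfr,
    ENNReal.ofReal_sub _ (by positivity), ENNReal.sub_mul]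
  intro _ _
  exact measure_ball_lt_top.ne

lemma sav_conv {N : ℕ} (hN : 5 ≤ N) {φ u : E N → ℝ} (h : Continuous φ) (hu : IsRadial u)
    (hum : AEStronglyMeasurable u volume) (R : ℝ) :
    ∫⁻ x in Metric.ball (0:E N) R, ‖sav φ ‖x‖ - (sph N).real univ * u x‖ₑ
      ≤ (sph N) univ * ∫⁻ x in Metric.ball (0:E N) R, ‖φ x - u x‖ₑ := by
  have hB : MeasurableSet (Metric.ball (0:E N) R) := measurableSet_ball
  rw [← lintegral_indicator hB, ← lintegral_indicator hB]
  have m1 : AEMeasurable ((Metric.ball (0:E N) R).indicator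
      fun x => ‖sav φ ‖x‖ - (sph N).real univ * u x‖ₑ) volume := by
    refine AEMeasurable.indicator ?_ hB
    exact ((((sav_meas h).comp measurable_norm).aemeasurable).sub
      (hum.aemeasurable.const_mul _)).enorm
  have m2 : AEMeasurable ((Metric.ball (0:E N) R).indicator
      fun x => ‖φ x - u x‖ₑ) volume := by
    refine AEMeasurable.indicator ?_ hB
    exact (h.measurable.aemeasurable.sub hum.aemeasurable).enorm
  rw [(polar hN _ m1).2, (polar hN _ m2).2, ← lintegral_const_mul' _ _ (measure_ne_top _ _)]
  refine setLIntegral_mono' measurableSet_Ioi fun r hr => ?_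
  have hr0 : 0 < r := hr
  rw [mul_left_comm]
  refine mul_le_mul' le_rfl ?_
  have hn : ∀ θ : Metric.sphere (0 : E N) 1, ‖r • θ.1‖ = r := fun θ => by
    have hθ : ‖θ.1‖ = 1 := by simp
    simp [norm_smul, hθ, abs_of_pos hr0]
  by_cases hrR : r < R
  · have hmem : ∀ θ : Metric.sphere (0 : E N) 1, r • θ.1 ∈ Metric.ball (0:E N) R := fun θ => by
      rw [mem_ball_zero_iff, hn]; exact hrR
    calc ∫⁻ θ, (Metric.ball (0:E N) R).indicator
          (fun x => ‖sav φ ‖x‖ - (sph N).real univ * u x‖ₑ) (r • θ.1) ∂(sph N)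
        ≤ ∫⁻ θ, (∫⁻ θ', (Metric.ball (0:E N) R).indicator
          (fun x => ‖φ x - u x‖ₑ) (r • θ'.1) ∂(sph N)) ∂(sph N) := by
          refine lintegral_mono fun θ => ?_
          rw [indicator_of_mem (hmem θ), hn]
          have e : sav φ r - (sph N).real univ * u (r • θ.1)
              = ∫ θ', (φ (r • θ'.1) - u (r • θ'.1)) ∂(sph N) := by
            have : ∀ θ' : Metric.sphere (0 : E N) 1, u (r • θ'.1) = u (r • θ.1) :=
              fun θ' => hu _ _ (by rw [hn, hn])
            simp_rw [this]
            rw [integral_sub (sav_int h r) (integrable_const _), integral_const, smul_eq_mul]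
            rfl
          rw [e]
          refine (enorm_integral_le_lintegral_enorm _).trans (lintegral_mono fun θ' => ?_)
          rw [indicator_of_mem (hmem θ')]
      _ = _ := by rw [lintegral_const, mul_comm]
  · have hmem : ∀ θ : Metric.sphere (0 : E N) 1, r • θ.1 ∉ Metric.ball (0:E N) R := fun θ => by
      rw [mem_ball_zero_iff, hn]; exact hrR
    have : ∀ θ : Metric.sphere (0 : E N) 1, (Metric.ball (0:E N) R).indicator
          (fun x => ‖sav φ ‖x‖ - (sph N).real univ * u x‖ₑ) (r • θ.1) = 0 := fun θ =>
      indicator_of_notMem (hmem θ) _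
    rw [lintegral_congr this, lintegral_zero]
    exact zero_le

open MeasureTheory Filter Topology Set ENNReal

/-- modulus of continuity -/
noncomputable def omg (N : ℕ) (a b : ℝ) : ℝ≥0∞ :=
  ENNReal.ofReal ((a^(N-1))⁻¹) *
    (ENNReal.ofReal (b^N - a^N) * volume (Metric.ball (0:E N) 1)) ^ (1 - 1 / (pstar N : ℝ))

lemma pstar_val {N : ℕ} (hN : 5 ≤ N) : (pstar N : ℝ) = 2 * N / (N - 2) := by
  have h5 : (5:ℝ) ≤ N := by exact_mod_cast hN
  exact Real.coe_toNNReal _ (div_nonneg (by linarith) (by linarith))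

lemma one_lt_pstar {N : ℕ} (hN : 5 ≤ N) : (1:ℝ) < pstar N := by
  have h5 : (5:ℝ) ≤ N := by exact_mod_cast hN
  rw [pstar_val hN, lt_div_iff₀ (by linarith)]; linarith

lemma alpha_pos {N : ℕ} (hN : 5 ≤ N) : 0 < 1 - 1 / (pstar N : ℝ) := by
  have := one_lt_pstar hN
  rw [sub_pos, div_lt_one (by linarith)]; exact this

lemma sav_est2 {N : ℕ} (hN : 5 ≤ N) : ∃ C : NNReal, ∀ φ : E N → ℝ, ContDiff ℝ (⊤ : ℕ∞) φ →
    HasCompactSupport φ → ∀ a b : ℝ, 0 < a → a ≤ b →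
    ‖sav φ b - sav φ a‖ₑ ≤ C * omg N a b * eLpNorm (lapl φ) 2 volume := by
  obtain ⟨C, hC⟩ := sobolev_smooth hN
  refine ⟨C, fun φ h hs a b ha hab => ?_⟩
  refine (sav_est hN h ha hab).trans ?_
  have hcont := (h.fderiv_right (m := (⊤ : ℕ∞)) (by simp)).continuous
  have h1 : (1:ℝ≥0∞) ≤ (pstar N : ℝ≥0∞) := by
    have : 1 ≤ pstar N := by
      rw [← NNReal.coe_le_coe]; exact (one_lt_pstar hN).le
    exact_mod_cast this
  have h2 := eLpNorm_le_eLpNorm_mul_rpow_measure_univ (μ := volume.restrict (ann N a b)) h1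
    (hcont.aestronglyMeasurable (μ := volume.restrict (ann N a b)))
  rw [eLpNorm_one_eq_lintegral_enorm, Measure.restrict_apply_univ, ann_vol hN ha hab] at h2
  simp only [ENNReal.toReal_one, div_one, ENNReal.coe_toReal] at h2
  calc _ ≤ ENNReal.ofReal ((a^(N-1))⁻¹) * ((C * eLpNorm (lapl φ) 2 volume) *
          (ENNReal.ofReal (b^N - a^N) * volume (Metric.ball (0:E N) 1)) ^ (1 - 1 / (pstar N : ℝ))) := by
        gcongr
        refine h2.trans ?_
        gcongr
        exact (eLpNorm_mono_measure _ Measure.restrict_le_self).trans (hC φ h hs).1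
    _ = _ := by unfold omg; ring

lemma sph_pos {N : ℕ} (hN : 5 ≤ N) : 0 < (sph N).real univ := by
  have hfr : Module.finrank ℝ (E N) = N := by simp
  have : Nonempty (Fin N) := ⟨⟨0, by omega⟩⟩
  have : Nontrivial (E N) := by
    apply Module.nontrivial_of_finrank_pos (R := ℝ); rw [hfr]; omega
  rw [measureReal_def, ENNReal.toReal_pos_iff]
  exact ⟨pos_iff_ne_zero.2 (by rw [Ne, Measure.measure_univ_eq_zero]; exact Measure.toSphere_ne_zero _),
    measure_lt_top _ _⟩

lemma radial_aux {N : ℕ} (hN : 5 ≤ N) {u w : E N → ℝ} (hu : IsRadial u) (hm : MemLp u (twoSS N) volume)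
    {φ : ℕ → E N → ℝ} (hφ : ∀ n, ContDiff ℝ (⊤ : ℕ∞) (φ n))
    (h1 : Tendsto (fun n => eLpNorm (fun x => φ n x - u x) (twoSS N) volume) atTop (𝓝 0)) (R : ℝ) :
    ∃ ns : ℕ → ℕ, StrictMono ns ∧ ∀ᵐ x, x ∈ Metric.ball (0:E N) R →
      Tendsto (fun k => sav (φ (ns k)) ‖x‖) atTop (𝓝 ((sph N).real univ * u x)) := by
  set μ := volume.restrict (Metric.ball (0:E N) R)
  have hfin : μ univ ≠ ⊤ := by
    rw [Measure.restrict_apply_univ]; exact measure_ball_lt_top.ne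
  have key : ∀ n, eLpNorm (fun x => sav (φ n) ‖x‖ - (sph N).real univ * u x) 1 μ
      ≤ (sph N) univ * (eLpNorm (fun x => φ n x - u x) (twoSS N) volume *
        μ univ ^ (1 - 1 / (twoSS N).toReal)) := by
    intro n
    rw [eLpNorm_one_eq_lintegral_enorm]
    refine (sav_conv hN (hφ n).continuous hu hm.1 R).trans ?_
    gcongr
    have := eLpNorm_le_eLpNorm_mul_rpow_measure_univ (μ := μ) (one_le_twoSS hN)
      (((hφ n).continuous.aestronglyMeasurable.sub hm.1).restrict (s := Metric.ball (0:E N) R))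
    rw [eLpNorm_one_eq_lintegral_enorm] at this
    simp only [ENNReal.toReal_one, div_one] at this
    refine this.trans ?_
    gcongr
    exact eLpNorm_mono_measure _ Measure.restrict_le_self
  have hexp : 0 ≤ 1 - 1 / (twoSS N).toReal := by
    have h2 : 1 ≤ (twoSS N).toReal := by
      have := ENNReal.toReal_mono (by rw [twoSS_eq hN]; exact coe_ne_top) (one_le_twoSS hN)
      simpa using this
    rw [sub_nonneg, div_le_one (by linarith)]; exact h2
  have lim : Tendsto (fun n => eLpNorm ((fun n x => sav (φ n) ‖x‖) n - fun x => (sph N).real univ * u x) 1 μ)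
      atTop (𝓝 0) := by
    have l1 := ENNReal.Tendsto.mul_const (b := μ univ ^ (1 - 1 / (twoSS N).toReal)) h1
      (Or.inr (ENNReal.rpow_ne_top_of_nonneg hexp hfin))
    have l2 := ENNReal.Tendsto.const_mul (a := (sph N) univ) l1 (Or.inr (measure_ne_top _ _))
    rw [zero_mul, mul_zero] at l2
    exact tendsto_of_tendsto_of_tendsto_of_le_of_le tendsto_const_nhds l2 (fun n => zero_le) key
  have tm := tendstoInMeasure_of_tendsto_eLpNorm (one_ne_zero)
    (fun n => ((sav_meas (hφ n).continuous).comp measurable_norm).aestronglyMeasurable)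
    ((hm.1.const_mul _).restrict) lim
  obtain ⟨ns, hns, h⟩ := tm.exists_seq_tendsto_ae
  refine ⟨ns, hns, ?_⟩
  exact (ae_restrict_iff' measurableSet_ball).1 h

lemma radial_est {N : ℕ} (hN : 5 ≤ N) : ∃ C : NNReal, ∀ u w : E N → ℝ, MemD22 N u w →
    IsRadial u → ∃ G : Set (E N), (∀ᵐ x, x ∈ G) ∧ ∀ x ∈ G, ∀ y ∈ G, x ≠ 0 → ‖x‖ ≤ ‖y‖ →
      ‖u y - u x‖ₑ ≤ C * omg N ‖x‖ ‖y‖ * eLpNorm w 2 volume := by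
  obtain ⟨C, hC⟩ := sav_est2 hN
  set S := (sph N).real univ
  have hS : 0 < S := sph_pos hN
  refine ⟨Real.toNNReal S⁻¹ * C, fun u w ⟨hu, hw, φ, hφ, h1, h2⟩ hr => ?_⟩
  choose ns hns hae using fun R : ℕ => radial_aux hN (w := w) hr hu (fun n => (hφ n).1) h1 (R:ℝ)
  refine ⟨{x | ∀ R : ℕ, x ∈ Metric.ball (0:E N) R →
      Tendsto (fun k => sav (φ (ns R k)) ‖x‖) atTop (𝓝 (S * u x))}, ae_all_iff.2 hae, ?_⟩
  intro x hx y hy hx0 hxy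
  obtain ⟨R, hR⟩ := exists_nat_gt ‖y‖
  have tx := hx R (by rw [mem_ball_zero_iff]; linarith)
  have ty := hy R (by rw [mem_ball_zero_iff]; linarith)
  have t1 := ((ty.sub tx).enorm)
  have hom : C * omg N ‖x‖ ‖y‖ ≠ ⊤ := by
    refine ENNReal.mul_ne_top coe_ne_top (ENNReal.mul_ne_top ofReal_ne_top ?_)
    exact ENNReal.rpow_ne_top_of_nonneg (alpha_pos hN).le
      (ENNReal.mul_ne_top ofReal_ne_top measure_ball_lt_top.ne)
  have t2 := ENNReal.Tendsto.const_mul (a := C * omg N ‖x‖ ‖y‖)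
    ((h2.comp (hns R).tendsto_atTop).add_const (eLpNorm w 2 volume)) (Or.inr hom)
  rw [zero_add] at t2
  have t3 := le_of_tendsto_of_tendsto' t1 t2 fun k => by
    refine (hC _ (hφ _).1 (hφ _).2 _ _ (norm_pos_iff.2 hx0) hxy).trans ?_
    refine mul_le_mul' le_rfl ?_
    have m2 := (lapl_contDiff (hφ (ns R k)).1).continuous.aestronglyMeasurable (μ := volume)
    have e2 : lapl (φ (ns R k)) = (fun x => lapl (φ (ns R k)) x - w x) + w := by funext x; simp
    conv_lhs => rw [e2]
    exact eLpNorm_add_le (m2.sub hw.1) hw.1 (by norm_num)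
  have e : u y - u x = S⁻¹ * (S * u y - S * u x) := by field_simp
  rw [e, enorm_mul]
  have e3 : ‖S⁻¹‖ₑ = (Real.toNNReal S⁻¹ : ℝ≥0∞) := by
    rw [Real.enorm_eq_ofReal (by positivity)]; rfl
  rw [e3, ENNReal.coe_mul, mul_assoc, mul_assoc]
  refine mul_le_mul' le_rfl ?_
  rw [← mul_assoc]; exact t3

lemma omg_le {N : ℕ} (hN : 5 ≤ N) {a b c d : ℝ} (ha : 0 < a) (hac : a ≤ c) (hdb : d ≤ b) (hc : 0 ≤ d) :
    omg N c d ≤ omg N a b := by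
  unfold omg
  refine mul_le_mul' (ENNReal.ofReal_le_ofReal ?_) ?_
  · exact inv_anti₀ (by positivity) (pow_le_pow_left₀ ha.le hac _)
  · refine ENNReal.rpow_le_rpow ?_ (alpha_pos hN).le
    refine mul_le_mul' (ENNReal.ofReal_le_ofReal ?_) le_rfl
    have := pow_le_pow_left₀ hc hdb N
    have := pow_le_pow_left₀ ha.le hac N
    linarith

lemma omg_ne_top {N : ℕ} (hN : 5 ≤ N) (a b : ℝ) : omg N a b ≠ ⊤ := by
  refine (ENNReal.mul_ne_top ofReal_ne_top ?_)
  exact ENNReal.rpow_ne_top_of_nonneg (alpha_pos hN).le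
      (ENNReal.mul_ne_top ofReal_ne_top measure_ball_lt_top.ne)

/-- uniform bound on annuli -/
lemma radial_bdd {N : ℕ} (hN : 5 ≤ N) {a b : ℝ} (ha : 0 < a) (hab : a < b) :
    ∃ C : NNReal, ∀ u w : E N → ℝ, MemD22 N u w → IsRadial u →
      ∀ᵐ x, a < ‖x‖ → ‖x‖ ≤ b → ‖u x‖ₑ ≤ C * eLpNorm w 2 volume := by
  obtain ⟨C1, hC1⟩ := radial_est hN
  obtain ⟨C2, hC2⟩ := sobolev_D22 hN
  have : Nonempty (Fin N) := ⟨⟨0, by omega⟩⟩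
  set m := volume (ann N a b) with hm
  have hmv := ann_vol hN ha hab.le
  have hm0 : m ≠ 0 := by
    rw [hm, hmv]
    refine mul_ne_zero ?_ (Metric.measure_ball_pos _ _ one_pos).ne'
    rw [Ne, ENNReal.ofReal_eq_zero, not_le, sub_pos]
    exact pow_lt_pow_left₀ hab ha.le (by omega)
  have hmt : m ≠ ⊤ := by
    rw [hm, hmv]; exact ENNReal.mul_ne_top ofReal_ne_top measure_ball_lt_top.ne
  have hexp : 0 ≤ 1 - 1 / (twoSS N).toReal := by
    have h2 : 1 ≤ (twoSS N).toReal := by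
      have := ENNReal.toReal_mono (by rw [twoSS_eq hN]; exact coe_ne_top) (one_le_twoSS hN)
      simpa using this
    rw [sub_nonneg, div_le_one (by linarith)]; exact h2
  set D : ℝ≥0∞ := m⁻¹ * (C2 * m ^ (1 - 1 / (twoSS N).toReal) + C1 * omg N a b * m) with hD
  have hDt : D ≠ ⊤ := by
    refine ENNReal.mul_ne_top (ENNReal.inv_ne_top.2 hm0) (ENNReal.add_ne_top.2 ⟨?_, ?_⟩)
    · exact ENNReal.mul_ne_top coe_ne_top (ENNReal.rpow_ne_top_of_nonneg hexp hmt)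
    · exact ENNReal.mul_ne_top (ENNReal.mul_ne_top coe_ne_top (omg_ne_top hN _ _)) hmt
  refine ⟨D.toNNReal, fun u w hmem hr => ?_⟩
  rw [ENNReal.coe_toNNReal hDt]
  obtain ⟨G, hG, hest⟩ := hC1 u w hmem hr
  filter_upwards [hG] with x hx hax hxb
  have hb : ∀ y ∈ G, y ∈ ann N a b → ‖u x‖ₑ ≤ ‖u y‖ₑ + C1 * omg N a b * eLpNorm w 2 volume := by
    intro y hy hyA
    have hd : ‖u x - u y‖ₑ ≤ C1 * omg N a b * eLpNorm w 2 volume := by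
      rcases le_total ‖x‖ ‖y‖ with h | h
      · rw [enorm_sub_rev]
        refine (hest x hx y hy (norm_pos_iff.1 (ha.trans hax)) h).trans ?_
        gcongr
        exact omg_le hN ha hax.le hyA.2 (norm_nonneg _)
      · refine (hest y hy x hx (norm_pos_iff.1 (ha.trans hyA.1)) h).trans ?_
        gcongr
        exact omg_le hN ha hyA.1.le hxb (norm_nonneg _)
    calc ‖u x‖ₑ = ‖u y + (u x - u y)‖ₑ := by congr 1; ring
      _ ≤ ‖u y‖ₑ + ‖u x - u y‖ₑ := enorm_add_le _ _
      _ ≤ _ := by gcongr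
  have hKint : ‖u x‖ₑ * m ≤ (C2 * m ^ (1 - 1 / (twoSS N).toReal) + C1 * omg N a b * m)
      * eLpNorm w 2 volume := by
    calc ‖u x‖ₑ * m = ∫⁻ y in ann N a b, ‖u x‖ₑ := by rw [setLIntegral_const]
      _ ≤ ∫⁻ y in ann N a b, (‖u y‖ₑ + C1 * omg N a b * eLpNorm w 2 volume) := by
          refine setLIntegral_mono_ae' (ann_meas N a b) ?_
          filter_upwards [hG] with y hy hyA using hb y hy hyA
      _ = (∫⁻ y in ann N a b, ‖u y‖ₑ) + C1 * omg N a b * eLpNorm w 2 volume * m := by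
          rw [lintegral_add_right _ measurable_const, setLIntegral_const]
      _ ≤ C2 * eLpNorm w 2 volume * m ^ (1 - 1 / (twoSS N).toReal)
          + C1 * omg N a b * eLpNorm w 2 volume * m := by
          gcongr
          have := eLpNorm_le_eLpNorm_mul_rpow_measure_univ (μ := volume.restrict (ann N a b))
            (one_le_twoSS hN) hmem.1.1.restrict
          rw [eLpNorm_one_eq_lintegral_enorm, Measure.restrict_apply_univ] at this
          simp only [ENNReal.toReal_one, div_one] at this
          refine this.trans ?_
          gcongr
          exact (eLpNorm_mono_measure _ Measure.restrict_le_self).trans (hC2 u w hmem)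
      _ = _ := by ring
  calc ‖u x‖ₑ = m⁻¹ * (‖u x‖ₑ * m) := by
        rw [mul_comm, mul_assoc, ENNReal.mul_inv_cancel hm0 hmt, mul_one]
    _ ≤ _ := by rw [hD, mul_assoc]; gcongr

open MeasureTheory Filter Topology Set ENNReal

lemma omg_tendsto {N : ℕ} (hN : 5 ≤ N) (x : E N) (hx : x ≠ 0) :
    Tendsto (fun d : E N => omg N (min ‖x‖ ‖d‖) (max ‖x‖ ‖d‖)) (𝓝 x) (𝓝 0) := by
  have hxp : 0 < ‖x‖ := norm_pos_iff.2 hx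
  have h1 : Tendsto (fun d : E N => min ‖x‖ ‖d‖) (𝓝 x) (𝓝 ‖x‖) := by
    have : Continuous (fun d : E N => min ‖x‖ ‖d‖) := by fun_prop
    simpa using this.tendsto x
  have h2 : Tendsto (fun d : E N => max ‖x‖ ‖d‖) (𝓝 x) (𝓝 ‖x‖) := by
    have : Continuous (fun d : E N => max ‖x‖ ‖d‖) := by fun_prop
    simpa using this.tendsto x
  have h3 := ENNReal.tendsto_ofReal ((h1.pow (N-1)).inv₀ (pow_ne_zero _ hxp.ne'))
  have h4 := ENNReal.tendsto_ofReal ((h2.pow N).sub (h1.pow N))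
  rw [sub_self, ENNReal.ofReal_zero] at h4
  have h5 := ENNReal.Tendsto.mul_const h4 (b := volume (Metric.ball (0:E N) 1))
    (Or.inr measure_ball_lt_top.ne)
  have h6 := (ENNReal.continuous_rpow_const (y := 1 - 1 / (pstar N : ℝ))).tendsto _ |>.comp h5
  have e : (0 * volume (Metric.ball (0:E N) 1)) ^ (1 - 1 / (pstar N : ℝ)) = (0:ℝ≥0∞) := by
    rw [zero_mul, ENNReal.zero_rpow_of_pos (alpha_pos hN)]
  rw [e] at h6
  have h7 := ENNReal.Tendsto.mul h3 (Or.inr ENNReal.zero_ne_top) h6 (Or.inr ofReal_ne_top)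
  rw [mul_zero] at h7
  exact h7

lemma cauchy_of_approx (v : ℕ → ℝ) (h : ∀ ε > 0, ∃ d : ℕ → ℝ, (∃ l, Tendsto d atTop (𝓝 l)) ∧
    ∀ k, |d k - v k| ≤ ε) : ∃ l, Tendsto v atTop (𝓝 l) := by
  apply cauchySeq_tendsto_of_complete
  rw [Metric.cauchySeq_iff']
  intro ε hε
  obtain ⟨d, ⟨l, hl⟩, hd⟩ := h (ε/4) (by linarith)
  have := hl.cauchySeq
  rw [Metric.cauchySeq_iff'] at this
  obtain ⟨n0, hn⟩ := this (ε/4) (by linarith)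
  refine ⟨n0, fun n hnn => ?_⟩
  have h1 := hn n hnn
  have h2 := hd n
  have h3 := hd n0
  rw [Real.dist_eq] at *
  rw [abs_lt] at *
  rw [abs_le] at *
  constructor <;> linarith

lemma diag {D : Type*} [Countable D] (v : ℕ → D → ℝ) (B : D → ℝ) (h : ∀ n d, |v n d| ≤ B d) :
    ∃ ψ : ℕ → ℕ, StrictMono ψ ∧ ∀ d, ∃ l, Tendsto (fun k => v (ψ k) d) atTop (𝓝 l) := by
  have hc : IsCompact (Set.pi univ fun d => Icc (-B d) (B d)) :=
    isCompact_univ_pi fun d => isCompact_Icc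
  obtain ⟨a, -, ψ, hψ, hl⟩ := hc.tendsto_subseq (x := v) fun n d _ => abs_le.1 (h n d)
  exact ⟨ψ, hψ, fun d => ⟨a d, (tendsto_pi_nhds.1 hl) d⟩⟩

lemma compact_ae {N : ℕ} (hN : 5 ≤ N) (u w : ℕ → E N → ℝ) (hm : ∀ n, MemD22 N (u n) (w n))
    (hr : ∀ n, IsRadial (u n)) (Λ : ℝ≥0∞) (hΛ : Λ ≠ ⊤) (hw : ∀ n, eLpNorm (w n) 2 volume ≤ Λ) :
    ∃ ψ : ℕ → ℕ, StrictMono ψ ∧ ∀ᵐ x, ∃ l, Tendsto (fun k => u (ψ k) x) atTop (𝓝 l) := by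
  have : Nonempty (Fin N) := ⟨⟨0, by omega⟩⟩
  obtain ⟨C1, hC1⟩ := radial_est hN
  choose G hG hest using fun n => hC1 (u n) (w n) (hm n) (hr n)
  choose C2 hC2 using fun m : ℕ => radial_bdd hN (a := 1/((m:ℝ)+2)) (b := (m:ℝ)+2) (by positivity)
    (by rw [div_lt_iff₀ (by positivity)]; nlinarith [(Nat.cast_nonneg m : (0:ℝ) ≤ m)])
  set H : Set (E N) := {x | x ≠ 0 ∧ (∀ n, x ∈ G n) ∧ ∀ m n : ℕ, 1/((m:ℝ)+2) < ‖x‖ → ‖x‖ ≤ (m:ℝ)+2 →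
    ‖u n x‖ₑ ≤ C2 m * eLpNorm (w n) 2 volume} with hHdef
  have hH : ∀ᵐ x, x ∈ H := by
    have h0 : ∀ᵐ x : E N, x ≠ 0 := by
      simp [ae_iff]
    filter_upwards [h0, ae_all_iff.2 hG, ae_all_iff.2 fun m => ae_all_iff.2 fun n =>
      hC2 m (u n) (w n) (hm n) (hr n)] with x a b c using ⟨a, b, c⟩
  have hdense : Dense H := Measure.dense_of_ae hH
  obtain ⟨D, hDH, hDc, hDd⟩ := hdense.exists_countable_dense_subset
  have := hDc.to_subtype
  have hbd : ∀ x ∈ H, ∃ B : ℝ, ∀ n, |u n x| ≤ B := by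
    intro x hx
    have hxp : 0 < ‖x‖ := norm_pos_iff.2 hx.1
    obtain ⟨m, hm1⟩ := exists_nat_gt (max ‖x‖ (1/‖x‖))
    have a1 := (le_max_left _ _).trans_lt hm1
    have a2 := (le_max_right _ _).trans_lt hm1
    refine ⟨(C2 m * Λ).toReal, fun n => ?_⟩
    have := hx.2.2 m n (by
      rw [div_lt_iff₀ (by positivity)]; rw [div_lt_iff₀ hxp] at a2; nlinarith) (by linarith)
    have h2 : ‖u n x‖ₑ ≤ C2 m * Λ := this.trans (by gcongr; exact hw n)
    have h3 := ENNReal.toReal_mono (ENNReal.mul_ne_top coe_ne_top hΛ) h2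
    simpa using h3
  choose! B hB using hbd
  obtain ⟨ψ, hψ, hl⟩ := diag (D := D) (fun n d => u n d) (fun d => B d) fun n d => hB d (hDH d.2) n
  refine ⟨ψ, hψ, ?_⟩
  filter_upwards [hH] with x hx
  apply cauchy_of_approx
  intro ε hε
  have ht := ENNReal.Tendsto.mul_const (ENNReal.Tendsto.const_mul (omg_tendsto hN x hx.1)
    (a := (C1:ℝ≥0∞)) (Or.inr coe_ne_top)) (b := Λ) (Or.inr hΛ)
  rw [mul_zero, zero_mul] at ht
  have hev := ht.eventually (gt_mem_nhds (ENNReal.ofReal_pos.2 hε))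
  obtain ⟨d, hd, hdD⟩ := (mem_closure_iff_frequently.1 (hDd x)).and_eventually hev |>.exists
  refine ⟨fun k => u (ψ k) d, hl ⟨d, hd⟩, fun k => ?_⟩
  have key : ‖u (ψ k) d - u (ψ k) x‖ₑ ≤ ENNReal.ofReal ε := by
    refine le_trans ?_ hdD.le
    rcases le_total ‖x‖ ‖d‖ with h | h
    · rw [min_eq_left h, max_eq_right h]
      refine (hest _ x (hx.2.1 _) d ((hDH hd).2.1 _) hx.1 h).trans ?_
      gcongr
      exact hw _
    · rw [min_eq_right h, max_eq_left h, enorm_sub_rev]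
      refine (hest _ d ((hDH hd).2.1 _) x (hx.2.1 _) (hDH hd).1 h).trans ?_
      gcongr
      exact hw _
  rw [← ofReal_norm, ENNReal.ofReal_le_ofReal_iff hε.le] at key
  exact key

open MeasureTheory Filter Topology Set ENNReal

lemma twoSS_ne_zero {N : ℕ} (hN : 5 ≤ N) : twoSS N ≠ 0 :=
  (lt_of_lt_of_le zero_lt_one (one_le_twoSS hN)).ne'

lemma ae_zero_of_norm {N : ℕ} (hN : 5 ≤ N) {V : ℝ → ℝ≥0∞} {u w : E N → ℝ} (h : MemH2Vr V u w)
    (h0 : H2norm V u w = 0) : ∀ᵐ x, u x = 0 := by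
  obtain ⟨C, hC⟩ := sobolev_D22 hN
  have h1 := eLpNorm_w_le h
  rw [h0, ENNReal.ofReal_zero, nonpos_iff_eq_zero] at h1
  have h2 := hC u w h.1.1
  rw [h1, mul_zero, nonpos_iff_eq_zero, eLpNorm_eq_zero_iff h.1.1.1.1 (twoSS_ne_zero hN)] at h2
  exact h2

lemma scale_bd {N : ℕ} (hN : 5 ≤ N) {V : ℝ → ℝ≥0∞} (hV : Measurable V) {K : ℝ → ℝ} {q : ℝ}
    (hq : 2 < q) (A : Set (E N)) (S : ℝ≥0∞)
    (hS : ∀ u w h z : E N → ℝ, MemH2Vr V u w → MemH2Vr V h z → H2norm V u w = 1 →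
      H2norm V h z = 1 → ∫⁻ x in A, ENNReal.ofReal (K ‖x‖ * |u x| ^ (q-1) * |h x|) ≤ S)
    {u w h z : E N → ℝ} (hu : MemH2Vr V u w) (hh : MemH2Vr V h z) :
    ∫⁻ x in A, ENNReal.ofReal (K ‖x‖ * |u x| ^ (q-1) * |h x|) ≤
      ENNReal.ofReal (H2norm V u w ^ (q-1) * H2norm V h z) * S := by
  have hq0 : q - 1 ≠ 0 := by linarith
  rcases (H2norm_nonneg V u w).eq_or_lt with h0 | hup
  · have := ae_zero_of_norm hN hu h0.symm
    rw [lintegral_congr_ae (g := fun _ => 0)]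
    · simp
    · filter_upwards [ae_restrict_of_ae this] with x hx
      simp [hx, Real.zero_rpow hq0]
  rcases (H2norm_nonneg V h z).eq_or_lt with h0 | hhp
  · have := ae_zero_of_norm hN hh h0.symm
    rw [lintegral_congr_ae (g := fun _ => 0)]
    · simp
    · filter_upwards [ae_restrict_of_ae this] with x hx
      simp [hx]
  set a := H2norm V u w
  set b := H2norm V h z
  have m1 := hu.smul hN hV a⁻¹
  have m2 := hh.smul hN hV b⁻¹
  have n1 := H2norm_smul hV (inv_nonneg.2 hup.le) hu
  have n2 := H2norm_smul hV (inv_nonneg.2 hhp.le) hh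
  have := hS _ _ _ _ m1 m2 (n1.trans (inv_mul_cancel₀ hup.ne')) (n2.trans (inv_mul_cancel₀ hhp.ne'))
  have hc : 0 ≤ a ^ (q-1) * b := mul_nonneg (Real.rpow_nonneg hup.le _) hhp.le
  refine le_trans (le_of_eq ?_) (mul_le_mul' le_rfl this)
  rw [← lintegral_const_mul' _ _ ofReal_ne_top]
  refine lintegral_congr fun x => ?_
  rw [← ENNReal.ofReal_mul hc]
  congr 1
  rw [abs_mul, abs_mul, abs_of_pos (inv_pos.2 hup), abs_of_pos (inv_pos.2 hhp),
    Real.mul_rpow (inv_nonneg.2 hup.le) (abs_nonneg _), Real.inv_rpow hup.le]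
  have := (Real.rpow_pos_of_pos hup (q-1)).ne'
  field_simp

lemma R0_bd {N : ℕ} (hN : 5 ≤ N) {V : ℝ → ℝ≥0∞} (hV : Measurable V) {K : ℝ → ℝ} {q : ℝ}
    (hq : 2 < q) (R : ℝ) {u w h z : E N → ℝ} (hu : MemH2Vr V u w) (hh : MemH2Vr V h z) :
    ∫⁻ x in Metric.ball 0 R, ENNReal.ofReal (K ‖x‖ * |u x| ^ (q-1) * |h x|) ≤
      ENNReal.ofReal (H2norm V u w ^ (q-1) * H2norm V h z) * R0 N V K q R := by
  refine scale_bd hN hV hq _ _ (fun u w h z a b c d => ?_) hu hh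
  exact le_iSup (fun p : {p : ((E N → ℝ) × (E N → ℝ)) × ((E N → ℝ) × (E N → ℝ)) //
      MemH2Vr V p.1.1 p.1.2 ∧ MemH2Vr V p.2.1 p.2.2 ∧
      H2norm V p.1.1 p.1.2 = 1 ∧ H2norm V p.2.1 p.2.2 = 1} => ∫⁻ x in Metric.ball (0 : E N) R,
      ENNReal.ofReal (K ‖x‖ * |p.1.1.1 x| ^ (q - 1) * |p.1.2.1 x|)) ⟨((u, w), (h, z)), a, b, c, d⟩

lemma Rinf_bd {N : ℕ} (hN : 5 ≤ N) {V : ℝ → ℝ≥0∞} (hV : Measurable V) {K : ℝ → ℝ} {q : ℝ}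
    (hq : 2 < q) (R : ℝ) {u w h z : E N → ℝ} (hu : MemH2Vr V u w) (hh : MemH2Vr V h z) :
    ∫⁻ x in (Metric.ball 0 R)ᶜ, ENNReal.ofReal (K ‖x‖ * |u x| ^ (q-1) * |h x|) ≤
      ENNReal.ofReal (H2norm V u w ^ (q-1) * H2norm V h z) * Rinf N V K q R := by
  refine scale_bd hN hV hq _ _ (fun u w h z a b c d => ?_) hu hh
  exact le_iSup (fun p : {p : ((E N → ℝ) × (E N → ℝ)) × ((E N → ℝ) × (E N → ℝ)) //
      MemH2Vr V p.1.1 p.1.2 ∧ MemH2Vr V p.2.1 p.2.2 ∧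
      H2norm V p.1.1 p.1.2 = 1 ∧ H2norm V p.2.1 p.2.2 = 1} => ∫⁻ x in (Metric.ball (0 : E N) R)ᶜ,
      ENNReal.ofReal (K ‖x‖ * |p.1.1.1 x| ^ (q - 1) * |p.1.2.1 x|)) ⟨((u, w), (h, z)), a, b, c, d⟩

lemma K_ann {N : ℕ} (hN : 5 ≤ N) {K : ℝ → ℝ} {s : ℝ} (hK : HypK K s) {a : ℝ} (b : ℝ) (ha : 0 < a) :
    ∫⁻ x in ann N a b, ENNReal.ofReal (K ‖x‖) < ⊤ := by
  obtain ⟨hpos, hKm, hs, hKint⟩ := hK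
  rw [← lintegral_indicator (ann_meas N a b)]
  have hm : Measurable (fun x : E N => ENNReal.ofReal (K ‖x‖)) := by fun_prop
  rw [(polar hN _ (hm.indicator (ann_meas N a b)).aemeasurable).2]
  have hle : ∀ r ∈ Ioi (0:ℝ), ENNReal.ofReal (r ^ (N-1)) *
      ∫⁻ θ, (ann N a b).indicator (fun x : E N => ENNReal.ofReal (K ‖x‖)) (r • θ.1) ∂(sph N)
      ≤ (Icc a b).indicator (fun r => ENNReal.ofReal (b ^ (N-1)) * (sph N) univ *
        (1 + ENNReal.ofReal (K r ^ s))) r := by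
    intro r hr
    have hn : ∀ θ : Metric.sphere (0 : E N) 1, ‖r • θ.1‖ = r := fun θ => by
      rw [norm_smul, norm_eq_of_mem_sphere θ, mul_one, Real.norm_of_nonneg (le_of_lt hr)]
    by_cases hrA : a < r ∧ r ≤ b
    · have hrI : r ∈ Icc a b := ⟨hrA.1.le, hrA.2⟩
      rw [indicator_of_mem hrI]
      have e : ∀ θ : Metric.sphere (0 : E N) 1,
          (ann N a b).indicator (fun x : E N => ENNReal.ofReal (K ‖x‖)) (r • θ.1)
          = ENNReal.ofReal (K r) := fun θ => by
        rw [indicator_of_mem, hn]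
        show _ ∧ _
        rw [hn]; exact hrA
      simp_rw [e]
      rw [lintegral_const, mul_comm (ENNReal.ofReal (K r)), ← mul_assoc]
      have h1 : ENNReal.ofReal (K r) ≤ 1 + ENNReal.ofReal (K r ^ s) := by
        rw [← ENNReal.ofReal_one, ← ENNReal.ofReal_add zero_le_one (Real.rpow_nonneg (hpos r hr).le _)]
        apply ENNReal.ofReal_le_ofReal
        rcases le_total (K r) 1 with h | h
        · have := Real.rpow_nonneg (hpos r hr).le s
          linarith
        · have := Real.rpow_le_rpow_of_exponent_le h hs.le
          rw [Real.rpow_one] at this; linarith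
      gcongr
      · exact le_of_lt hr
      · exact hrA.2
    · have e : ∀ θ : Metric.sphere (0 : E N) 1,
          (ann N a b).indicator (fun x : E N => ENNReal.ofReal (K ‖x‖)) (r • θ.1)
          = 0 := fun θ => by
        rw [indicator_of_notMem]
        show ¬ (_ ∧ _)
        rw [hn]; exact hrA
      simp_rw [e]
      simp
  refine (setLIntegral_mono' measurableSet_Ioi hle).trans_lt ?_
  refine (lintegral_mono' Measure.restrict_le_self le_rfl).trans_lt ?_
  rw [lintegral_indicator measurableSet_Icc, lintegral_const_mul' _ _
    (ENNReal.mul_ne_top ofReal_ne_top (measure_ne_top _ _)), lintegral_add_left measurable_const]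
  refine ENNReal.mul_lt_top (ENNReal.mul_lt_top ofReal_lt_top (measure_lt_top _ _)) ?_
  refine ENNReal.add_lt_top.2 ⟨by simp, ?_⟩
  have h2 := (hKint a b ha).2
  refine lt_of_le_of_lt (lintegral_mono fun r => ?_) h2
  rw [← ofReal_norm]
  exact ENNReal.ofReal_le_ofReal (le_abs_self _)

lemma split3 {N : ℕ} (F : E N → ℝ≥0∞) {R R' : ℝ} (hR : 0 < R) :
    ∫⁻ x, F x ≤ (∫⁻ x in Metric.ball 0 R, F x) + (∫⁻ x in (Metric.ball 0 R')ᶜ, F x)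
      + ∫⁻ x in ann N (R/2) R', F x := by
  have hsub : (univ : Set (E N)) ⊆ (Metric.ball 0 R ∪ (Metric.ball 0 R')ᶜ) ∪ ann N (R/2) R' := by
    intro x _
    by_cases h1 : ‖x‖ < R
    · left; left; simpa using h1
    by_cases h2 : ‖x‖ < R'
    · right; exact ⟨by linarith, h2.le⟩
    · left; right; simpa using h2
  rw [← setLIntegral_univ]
  refine (lintegral_mono_set hsub).trans ((lintegral_union_le _ _ _).trans ?_)
  gcongr
  exact lintegral_union_le _ _ _

lemma ae_K_nonneg {N : ℕ} (hN : 5 ≤ N) {K : ℝ → ℝ} {s : ℝ} (hK : HypK K s) :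
    ∀ᵐ x : E N, 0 ≤ K ‖x‖ := by
  have : Nonempty (Fin N) := ⟨⟨0, by omega⟩⟩
  have h0 : ∀ᵐ x : E N, x ≠ 0 := by
    simp [ae_iff]
  filter_upwards [h0] with x hx
  exact (hK.1 _ (norm_pos_iff.2 hx)).le

lemma K_int {N : ℕ} (hN : 5 ≤ N) {V : ℝ → ℝ≥0∞} (hV : Measurable V) {K : ℝ → ℝ} {s : ℝ}
    (hK : HypK K s) {q1 q2 : ℝ} (hq1 : 2 < q1) (hq2 : 2 < q2) (hR : Rcond N V K q1 q2)
    {u w h z : E N → ℝ} (hu : MemH2Vr V u w) (hh : MemH2Vr V h z) :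
    ∫⁻ x, ENNReal.ofReal (K ‖x‖ * min (|u x| ^ (q1-1)) (|u x| ^ (q2-1)) * |h x|) < ⊤ := by
  obtain ⟨R, hR0, hRp⟩ := ((hR.1.eventually (gt_mem_nhds zero_lt_one)).and
    self_mem_nhdsWithin).exists
  obtain ⟨R', hR'⟩ := (hR.2.eventually (gt_mem_nhds zero_lt_one)).exists
  have hRp : 0 < R := hRp
  have hKn := ae_K_nonneg hN hK
  refine (split3 _ (R' := R') hRp).trans_lt (ENNReal.add_lt_top.2 ⟨ENNReal.add_lt_top.2 ⟨?_, ?_⟩, ?_⟩)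
  · refine lt_of_le_of_lt ?_ ((R0_bd hN hV hq1 R hu hh).trans_lt
      (ENNReal.mul_lt_top ofReal_lt_top (hR0.trans one_lt_top)))
    refine lintegral_mono_ae ?_
    filter_upwards [ae_restrict_of_ae hKn] with x hx
    gcongr
    exact min_le_left _ _
  · refine lt_of_le_of_lt ?_ ((Rinf_bd hN hV hq2 R' hu hh).trans_lt
      (ENNReal.mul_lt_top ofReal_lt_top (hR'.trans one_lt_top)))
    refine lintegral_mono_ae ?_
    filter_upwards [ae_restrict_of_ae hKn] with x hx
    gcongr
    exact min_le_right _ _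
  · set b := max R R'
    obtain ⟨C, hC⟩ := radial_bdd hN (a := R/2) (b := b) (by positivity)
      (lt_of_lt_of_le (by linarith) (le_max_left _ _))
    have cu : (C * eLpNorm w 2 volume) ≠ ⊤ := ENNReal.mul_ne_top coe_ne_top hu.1.1.2.1.2.ne
    have ch : (C * eLpNorm z 2 volume) ≠ ⊤ := ENNReal.mul_ne_top coe_ne_top hh.1.1.2.1.2.ne
    refine lt_of_le_of_lt ?_ (ENNReal.mul_lt_top (a := ENNReal.ofReal
      ((C * eLpNorm w 2 volume).toReal ^ (q1-1) * (C * eLpNorm z 2 volume).toReal)) ofReal_lt_top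
      (K_ann hN hK R' (half_pos hRp)))
    rw [← lintegral_const_mul' _ _ ofReal_ne_top]
    refine setLIntegral_mono_ae' (ann_meas N _ _) ?_
    filter_upwards [hKn, hC u w hu.1.1 hu.2, hC h z hh.1.1 hh.2] with x hx h1 h2 hxA
    have h1 := ENNReal.toReal_mono cu (h1 hxA.1 (hxA.2.trans (le_max_right _ _)))
    have h2 := ENNReal.toReal_mono ch (h2 hxA.1 (hxA.2.trans (le_max_right _ _)))
    simp only [toReal_enorm, Real.norm_eq_abs] at h1 h2
    rw [← ENNReal.ofReal_mul (by positivity)]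
    apply ENNReal.ofReal_le_ofReal
    have h3 : min (|u x| ^ (q1-1)) (|u x| ^ (q2-1)) ≤ (C * eLpNorm w 2 volume).toReal ^ (q1-1) :=
      (min_le_left _ _).trans (Real.rpow_le_rpow (abs_nonneg _) h1 (by linarith))
    calc K ‖x‖ * min (|u x| ^ (q1-1)) (|u x| ^ (q2-1)) * |h x|
        ≤ K ‖x‖ * (C * eLpNorm w 2 volume).toReal ^ (q1-1) * (C * eLpNorm z 2 volume).toReal := by
          gcongr
      _ = _ := by ring

lemma K_integrable {N : ℕ} (hN : 5 ≤ N) {V : ℝ → ℝ≥0∞} (hV : Measurable V) {K : ℝ → ℝ} {s : ℝ}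
    (hK : HypK K s) {q1 q2 : ℝ} (hq1 : 2 < q1) (hq2 : 2 < q2) (hR : Rcond N V K q1 q2)
    {u w h z : E N → ℝ} (hu : MemH2Vr V u w) (hh : MemH2Vr V h z) {g : E N → ℝ} {M : ℝ} (hM : 0 ≤ M)
    (hg : AEStronglyMeasurable g volume)
    (hgb : ∀ x, |g x| ≤ M * min (|u x| ^ (q1-1)) (|u x| ^ (q2-1)) * |h x|) :
    Integrable (fun x => K ‖x‖ * g x) := by
  refine ⟨?_, ?_⟩
  · exact (hK.2.1.comp measurable_norm).aestronglyMeasurable.mul hg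
  · refine lt_of_le_of_lt ?_ (ENNReal.mul_lt_top (a := ENNReal.ofReal M) ofReal_lt_top
      (K_int hN hV hK hq1 hq2 hR hu hh))
    rw [← lintegral_const_mul' _ _ ofReal_ne_top]
    refine lintegral_mono_ae ?_
    filter_upwards [ae_K_nonneg hN hK] with x hx
    rw [← ofReal_norm, ← ENNReal.ofReal_mul hM]
    apply ENNReal.ofReal_le_ofReal
    rw [Real.norm_eq_abs, abs_mul, abs_of_nonneg hx]
    calc K ‖x‖ * |g x| ≤ K ‖x‖ * (M * min (|u x| ^ (q1-1)) (|u x| ^ (q2-1)) * |h x|) :=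
          mul_le_mul_of_nonneg_left (hgb x) hx
      _ = _ := by ring

open MeasureTheory Filter Topology Set ENNReal

lemma f_bd {f : ℝ → ℝ} {q1 q2 M : ℝ} (hM : 0 < M) (hfneg : ∀ t : ℝ, t < 0 → f t = 0)
    (h : ∀ t : ℝ, 0 ≤ t → |f t| ≤ M * min (t ^ (q1 - 1)) (t ^ (q2 - 1))) (t : ℝ) :
    |f t| ≤ M * min (|t| ^ (q1 - 1)) (|t| ^ (q2 - 1)) := by
  rcases lt_or_ge t 0 with h0 | h0
  · rw [hfneg t h0, abs_zero]; positivity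
  · rw [abs_of_nonneg h0]; exact h t h0

lemma Fint_neg {f : ℝ → ℝ} (hf0 : f 0 = 0) (hfneg : ∀ t : ℝ, t < 0 → f t = 0) {t : ℝ} (ht : t ≤ 0) :
    Fint f t = 0 := by
  unfold Fint
  rw [intervalIntegral.integral_congr (g := fun _ => 0)]
  · simp
  · intro x hx
    rw [uIcc_of_ge ht] at hx
    rcases hx.2.lt_or_eq with h | h
    · exact hfneg x h
    · rw [h]; exact hf0

lemma Fint_bd {f : ℝ → ℝ} {q1 q2 M : ℝ} (hM : 0 < M) (hq1 : 2 < q1) (hq2 : 2 < q2) (hf0 : f 0 = 0)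
    (hfneg : ∀ t : ℝ, t < 0 → f t = 0)
    (h : ∀ t : ℝ, 0 ≤ t → |f t| ≤ M * min (t ^ (q1 - 1)) (t ^ (q2 - 1))) (t : ℝ) :
    |Fint f t| ≤ M * min (|t| ^ (q1 - 1)) (|t| ^ (q2 - 1)) * |t| := by
  rcases le_or_gt t 0 with h0 | h0
  · rw [Fint_neg hf0 hfneg h0, abs_zero]; positivity
  · have := intervalIntegral.norm_integral_le_of_norm_le_const (f := f) (a := 0) (b := t)
      (C := M * min (t ^ (q1 - 1)) (t ^ (q2 - 1))) (fun x hx => by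
        rw [uIoc_of_le h0.le] at hx
        refine (h x hx.1.le).trans ?_
        have := hx.1.le
        have := hx.2
        gcongr <;> linarith)
    rw [sub_zero, Real.norm_eq_abs] at this
    rw [abs_of_pos h0] at *
    exact this

lemma Fint_cont {f : ℝ → ℝ} (hf : Continuous f) : Continuous (Fint f) :=
  intervalIntegral.continuous_primitive (fun a b => hf.intervalIntegrable a b) 0

lemma V_ae {N : ℕ} {V : ℝ → ℝ≥0∞} (hV : Measurable V) {u w : E N → ℝ} (h : MemH2Vr V u w) :
    ∀ᵐ x, V ‖x‖ * ENNReal.ofReal ((u x) ^ 2) = ENNReal.ofReal ((V ‖x‖).toReal * u x * u x) := by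
  have hum := h.1.1.1.1.aemeasurable
  have hm : AEMeasurable (fun x : E N => V ‖x‖ * ENNReal.ofReal ((u x) ^ 2)) volume :=
    (hV.comp measurable_norm).aemeasurable.mul (hum.pow_const 2).ennreal_ofReal
  filter_upwards [ae_lt_top' hm h.1.2.ne] with x hx
  by_cases hVt : V ‖x‖ = ⊤
  · have h0 : ENNReal.ofReal (u x ^ 2) = 0 := by
      by_contra hne
      rw [hVt, ENNReal.top_mul hne] at hx
      exact lt_irrefl _ hx
    rw [h0, hVt]; simp
  · rw [mul_assoc, ENNReal.ofReal_mul toReal_nonneg, ENNReal.ofReal_toReal hVt, sq]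

lemma V_int_sq {N : ℕ} {V : ℝ → ℝ≥0∞} (hV : Measurable V) {u w : E N → ℝ} (h : MemH2Vr V u w) :
    Integrable (fun x => (V ‖x‖).toReal * u x * u x) := by
  refine ⟨((hV.comp measurable_norm).ennreal_toReal.aestronglyMeasurable.mul h.1.1.1.1).mul h.1.1.1.1, ?_⟩
  refine lt_of_eq_of_lt ?_ h.1.2
  refine lintegral_congr_ae ?_
  filter_upwards [V_ae hV h] with x hx
  rw [hx, ← ofReal_norm, Real.norm_of_nonneg]
  rw [mul_assoc]; exact mul_nonneg toReal_nonneg (mul_self_nonneg _)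

lemma V_int {N : ℕ} {V : ℝ → ℝ≥0∞} (hV : Measurable V) {u w h z : E N → ℝ} (hu : MemH2Vr V u w)
    (hh : MemH2Vr V h z) : Integrable (fun x => (V ‖x‖).toReal * u x * h x) := by
  refine Integrable.mono' ((V_int_sq hV hu).add (V_int_sq hV hh))
    (((hV.comp measurable_norm).ennreal_toReal.aestronglyMeasurable.mul hu.1.1.1.1).mul hh.1.1.1.1)
    (Eventually.of_forall fun x => ?_)
  have : |u x * h x| ≤ u x * u x + h x * h x := by
    rw [abs_le]; constructor <;> nlinarith [sq_nonneg (u x + h x), sq_nonneg (u x - h x), sq_nonneg (u x), sq_nonneg (h x)]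
  have e : (0:ℝ) ≤ (V ‖x‖).toReal := toReal_nonneg
  rw [mul_assoc, Real.norm_eq_abs, abs_mul, abs_of_nonneg e]
  calc _ ≤ (V ‖x‖).toReal * (u x * u x + h x * h x) := mul_le_mul_of_nonneg_left this e
    _ = _ := by simp only [Pi.add_apply]; ring

lemma w_int {N : ℕ} {V : ℝ → ℝ≥0∞} {u w h z : E N → ℝ} (hu : MemH2Vr V u w)
    (hh : MemH2Vr V h z) : Integrable (fun x => w x * z x) :=
  MemLp.integrable_mul (p := 2) (q := 2) hu.1.1.2.1 hh.1.1.2.1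

/-- the scalar product -/
noncomputable def bil {N : ℕ} (V : ℝ → ℝ≥0∞) (u w h z : E N → ℝ) : ℝ :=
  (∫ x, w x * z x) + (∫ x, (V ‖x‖).toReal * u x * h x)

lemma norm_sq_bil {N : ℕ} {V : ℝ → ℝ≥0∞} (hV : Measurable V) {u w : E N → ℝ} (h : MemH2Vr V u w) :
    H2norm V u w ^ 2 = bil V u w u w := by
  rw [H2norm_sq]
  have h1 := QQ_lt_top h
  unfold QQ at *
  rw [ENNReal.toReal_add (ENNReal.add_lt_top.1 h1).1.ne (ENNReal.add_lt_top.1 h1).2.ne]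
  unfold bil
  congr 1
  · rw [integral_eq_lintegral_of_nonneg_ae (Eventually.of_forall fun x => mul_self_nonneg _)
      (w_int h h).1]
    simp_rw [sq]
  · rw [integral_eq_lintegral_of_nonneg_ae (Eventually.of_forall fun x => by
      simp only [Pi.zero_apply]; rw [mul_assoc]; exact mul_nonneg toReal_nonneg (mul_self_nonneg _))
      (V_int_sq hV h).1]
    rw [lintegral_congr_ae (V_ae hV h)]

lemma bil_sub {N : ℕ} (hN : 5 ≤ N) {V : ℝ → ℝ≥0∞} (hV : Measurable V) {u w u' w' h z : E N → ℝ}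
    (hu : MemH2Vr V u w) (hu' : MemH2Vr V u' w') (hh : MemH2Vr V h z) :
    bil V (fun x => u x - u' x) (fun x => w x - w' x) h z = bil V u w h z - bil V u' w' h z := by
  unfold bil
  have e1 : (∫ x, (w x - w' x) * z x) = (∫ x, w x * z x) - ∫ x, w' x * z x := by
    rw [← integral_sub (w_int hu hh) (w_int hu' hh)]
    congr 1; funext x; ring
  have e2 : (∫ x, (V ‖x‖).toReal * (u x - u' x) * h x) =
      (∫ x, (V ‖x‖).toReal * u x * h x) - ∫ x, (V ‖x‖).toReal * u' x * h x := by
    rw [← integral_sub (V_int hV hu hh) (V_int hV hu' hh)]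
    congr 1; funext x; ring
  rw [e1, e2]; ring

open MeasureTheory Filter Topology Set ENNReal

lemma quad_bd {c A X : ℝ} (hc : 0 < c) (h : c * X ^ 2 ≤ A + X) : X ≤ (|A| + 1) / c + 1 := by
  by_contra! hX
  have h1 : 0 ≤ (|A|+1)/c := by positivity
  have hX1 : 1 < X := by linarith
  have h2 : (|A|+1)/c < X := by linarith
  rw [div_lt_iff₀ hc] at h2
  have h3 := le_abs_self A
  nlinarith [mul_lt_mul_of_pos_right h2 (by linarith : 0 < X), abs_nonneg A]

lemma AR_bound {N : ℕ} (hN : 5 ≤ N) {K : ℝ → ℝ} {s : ℝ} (hK : HypK K s)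
    {f : ℝ → ℝ} (hf : Continuous f) (hf0 : f 0 = 0) (hfneg : ∀ t : ℝ, t < 0 → f t = 0)
    (hcase :
      ((∃ θ > (2:ℝ), ∀ t : ℝ, 0 ≤ t → 0 ≤ θ * Fint f t ∧ θ * Fint f t ≤ f t * t) ∧
        ∃ t0 > (0:ℝ), 0 < Fint f t0) ∨
      (Integrable (fun x : E N => K ‖x‖) ∧
        ∃ θ > (2:ℝ), ∃ t0 > (0:ℝ), ∀ t : ℝ, t0 ≤ t →
          0 < θ * Fint f t ∧ θ * Fint f t ≤ f t * t)) :
    ∃ θ > (2:ℝ), ∃ B' : ℝ, ∀ u : E N → ℝ, Integrable (fun x => K ‖x‖ * Fint f (u x)) →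
      Integrable (fun x => K ‖x‖ * f (u x) * u x) →
      (∫ x, K ‖x‖ * Fint f (u x)) ≤ B' + (1/θ) * ∫ x, K ‖x‖ * f (u x) * u x := by
  have hKn := ae_K_nonneg hN hK
  rcases hcase with ⟨⟨θ, hθ, h⟩, -⟩ | ⟨hKi, θ, hθ, t0, ht0, h⟩
  · refine ⟨θ, hθ, 0, fun u h1 h2 => ?_⟩
    rw [zero_add, ← integral_const_mul]
    refine integral_mono_ae h1 (h2.const_mul _) ?_
    filter_upwards [hKn] with x hx
    have key : Fint f (u x) ≤ (1/θ) * (f (u x) * u x) := by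
      rw [one_div, ← div_eq_inv_mul, le_div_iff₀ (by linarith)]
      rcases le_or_gt 0 (u x) with h0 | h0
      · linarith [(h _ h0).2]
      · rw [Fint_neg hf0 hfneg h0.le, hfneg _ h0]; simp
    calc _ ≤ K ‖x‖ * ((1/θ) * (f (u x) * u x)) := mul_le_mul_of_nonneg_left key hx
      _ = _ := by ring
  · have hcont : ContinuousOn (fun t => Fint f t - (1/θ) * (f t * t)) (Icc 0 t0) :=
      ((Fint_cont hf).sub (continuous_const.mul (hf.mul continuous_id))).continuousOn
    obtain ⟨C, hC⟩ := isCompact_Icc.bddAbove_image hcont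
    have hC0 : ∀ t, Fint f t ≤ |C| + (1/θ) * (f t * t) := by
      intro t
      rcases lt_or_ge t 0 with h0 | h0
      · rw [Fint_neg hf0 hfneg h0.le, hfneg _ h0]; simp
      rcases le_or_gt t t0 with h1 | h1
      · have := hC (mem_image_of_mem _ (⟨h0, h1⟩ : t ∈ Icc 0 t0))
        have := le_abs_self C
        linarith
      · have key : Fint f t ≤ (1/θ) * (f t * t) := by
          rw [one_div, ← div_eq_inv_mul, le_div_iff₀ (by linarith)]
          linarith [(h _ h1.le).2]
        linarith [abs_nonneg C]
    refine ⟨θ, hθ, |C| * ∫ x : E N, K ‖x‖, fun u h1 h2 => ?_⟩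
    rw [← integral_const_mul, ← integral_const_mul, ← integral_add (hKi.const_mul _) (h2.const_mul _)]
    refine integral_mono_ae h1 ((hKi.const_mul _).add (h2.const_mul _)) ?_
    filter_upwards [hKn] with x hx
    calc _ ≤ K ‖x‖ * (|C| + (1/θ) * (f (u x) * u x)) := mul_le_mul_of_nonneg_left (hC0 _) hx
      _ = _ := by ring

lemma Kfh_int {N : ℕ} (hN : 5 ≤ N) {V : ℝ → ℝ≥0∞} (hV : Measurable V) {K : ℝ → ℝ} {s : ℝ}
    (hK : HypK K s) {q1 q2 : ℝ} (hq1 : 2 < q1) (hq2 : 2 < q2) (hR : Rcond N V K q1 q2)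
    {f : ℝ → ℝ} (hf : Continuous f) (hfneg : ∀ t : ℝ, t < 0 → f t = 0) (hfg : Hypf f q1 q2)
    {u w h z : E N → ℝ} (hu : MemH2Vr V u w) (hh : MemH2Vr V h z) :
    Integrable (fun x => K ‖x‖ * f (u x) * h x) := by
  obtain ⟨M, hM, hb⟩ := hfg
  have := K_integrable hN hV hK hq1 hq2 hR hu hh (g := fun x => f (u x) * h x) hM.le
    ((hf.comp_aestronglyMeasurable hu.1.1.1.1).mul hh.1.1.1.1) (fun x => by
      rw [abs_mul]
      exact mul_le_mul_of_nonneg_right (f_bd hM hfneg hb _) (abs_nonneg _))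
  simpa only [mul_assoc] using this

lemma KF_int {N : ℕ} (hN : 5 ≤ N) {V : ℝ → ℝ≥0∞} (hV : Measurable V) {K : ℝ → ℝ} {s : ℝ}
    (hK : HypK K s) {q1 q2 : ℝ} (hq1 : 2 < q1) (hq2 : 2 < q2) (hR : Rcond N V K q1 q2)
    {f : ℝ → ℝ} (hf : Continuous f) (hf0 : f 0 = 0) (hfneg : ∀ t : ℝ, t < 0 → f t = 0)
    (hfg : Hypf f q1 q2) {u w : E N → ℝ} (hu : MemH2Vr V u w) :
    Integrable (fun x => K ‖x‖ * Fint f (u x)) := by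
  obtain ⟨M, hM, hb⟩ := hfg
  exact K_integrable hN hV hK hq1 hq2 hR hu hu (g := fun x => Fint f (u x)) hM.le
    ((Fint_cont hf).comp_aestronglyMeasurable hu.1.1.1.1) (fun x =>
      Fint_bd hM hq1 hq2 hf0 hfneg hb _)

lemma PS_bdd {N : ℕ} (hN : 5 ≤ N) {V : ℝ → ℝ≥0∞} (hV : Measurable V) {K : ℝ → ℝ} {s : ℝ}
    (hK : HypK K s) {q1 q2 : ℝ} (hq1 : 2 < q1) (hq2 : 2 < q2) (hR : Rcond N V K q1 q2)
    {f : ℝ → ℝ} (hf : Continuous f) (hf0 : f 0 = 0) (hfneg : ∀ t : ℝ, t < 0 → f t = 0)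
    (hfg : Hypf f q1 q2)
    (hcase :
      ((∃ θ > (2:ℝ), ∀ t : ℝ, 0 ≤ t → 0 ≤ θ * Fint f t ∧ θ * Fint f t ≤ f t * t) ∧
        ∃ t0 > (0:ℝ), 0 < Fint f t0) ∨
      (Integrable (fun x : E N => K ‖x‖) ∧
        ∃ θ > (2:ℝ), ∃ t0 > (0:ℝ), ∀ t : ℝ, t0 ≤ t →
          0 < θ * Fint f t ∧ θ * Fint f t ≤ f t * t))
    (u w : ℕ → E N → ℝ) (hmem : ∀ n, MemH2Vr V (u n) (w n))
    (hbdd : ∃ B : ℝ, ∀ n, |EulerI N V K (fun _ => 0) f (u n) (w n)| ≤ B)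
    (hderiv : ∀ ε > (0:ℝ), ∃ n0 : ℕ, ∀ n ≥ n0, ∀ h z : E N → ℝ, MemH2Vr V h z →
      |bil V (u n) (w n) h z - ∫ x, K ‖x‖ * f (u n x) * h x| ≤ ε * H2norm V h z) :
    ∃ Λ : ℝ, ∃ n0 : ℕ, 0 ≤ Λ ∧ ∀ n ≥ n0, H2norm V (u n) (w n) ≤ Λ := by
  obtain ⟨B, hB⟩ := hbdd
  obtain ⟨θ, hθ, B', hB'⟩ := AR_bound hN hK hf hf0 hfneg hcase
  obtain ⟨n0, hn0⟩ := hderiv 1 one_pos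
  have hc : 0 < 1/2 - 1/θ := by
    have : 1/θ < 1/2 := one_div_lt_one_div_of_lt (by norm_num) hθ
    linarith
  refine ⟨(|B + B'| + 1) / (1/2 - 1/θ) + 1, n0, by positivity, fun n hn => quad_bd hc ?_⟩
  have h1 := hB n
  have h2 := hn0 n hn _ _ (hmem n)
  have h3 := hB' (u n) (KF_int hN hV hK hq1 hq2 hR hf hf0 hfneg hfg (hmem n))
    (Kfh_int hN hV hK hq1 hq2 hR hf hfneg hfg (hmem n) (hmem n))
  rw [← norm_sq_bil hV (hmem n)] at h2
  unfold EulerI at h1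
  simp only [zero_mul, integral_zero, sub_zero] at h1
  set X := H2norm V (u n) (w n)
  have hX : 0 ≤ X := H2norm_nonneg _ _ _
  rw [abs_le] at h1 h2
  have hθ1 : 0 < 1/θ := by positivity
  have hθ2 : 1/θ ≤ 1 := by rw [div_le_one (by linarith)]; linarith
  have h4 : (1/θ) * ∫ x, K ‖x‖ * f (u n x) * u n x ≤ (1/θ) * (X^2 + X) :=
    mul_le_mul_of_nonneg_left (by linarith) hθ1.le
  nlinarith [mul_le_mul_of_nonneg_right hθ2 hX]

open MeasureTheory Filter Topology Set ENNReal

lemma sub_norm_le {N : ℕ} (hN : 5 ≤ N) {V : ℝ → ℝ≥0∞} (hV : Measurable V) {u w u' w' : E N → ℝ}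
    (hu : MemH2Vr V u w) (hu' : MemH2Vr V u' w') {Λ : ℝ} (hΛ : 0 ≤ Λ) (h1 : H2norm V u w ≤ Λ)
    (h2 : H2norm V u' w' ≤ Λ) :
    H2norm V (fun x => u x - u' x) (fun x => w x - w' x) ≤ 2 * Λ := by
  have hh := hu.sub hN hV hu'
  have key : bil V (fun x => u x - u' x) (fun x => w x - w' x) (fun x => u x - u' x)
      (fun x => w x - w' x) ≤ 2 * bil V u w u w + 2 * bil V u' w' u' w' := by
    have a1 : (∫ x, (w x - w' x) * (w x - w' x)) ≤ ∫ x, (2 * (w x * w x) + 2 * (w' x * w' x)) := by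
      refine integral_mono (w_int hh hh) (((w_int hu hu).const_mul 2).add ((w_int hu' hu').const_mul 2))
        fun x => ?_
      simp only
      nlinarith [sq_nonneg (w x + w' x)]
    have a2 : (∫ x, (V ‖x‖).toReal * (u x - u' x) * (u x - u' x)) ≤
        ∫ x, (2 * ((V ‖x‖).toReal * u x * u x) + 2 * ((V ‖x‖).toReal * u' x * u' x)) := by
      refine integral_mono (V_int hV hh hh)
        (((V_int hV hu hu).const_mul 2).add ((V_int hV hu' hu').const_mul 2)) fun x => ?_
      have e : (0:ℝ) ≤ (V ‖x‖).toReal := toReal_nonneg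
      simp only
      nlinarith [mul_nonneg e (sq_nonneg (u x + u' x))]
    rw [integral_add ((w_int hu hu).const_mul 2) ((w_int hu' hu').const_mul 2),
      integral_const_mul, integral_const_mul] at a1
    rw [integral_add ((V_int hV hu hu).const_mul 2) ((V_int hV hu' hu').const_mul 2),
      integral_const_mul, integral_const_mul] at a2
    unfold bil
    linarith
  rw [← norm_sq_bil hV hh, ← norm_sq_bil hV hu, ← norm_sq_bil hV hu'] at key
  refine abs_le_of_sq_le_sq' ?_ (by linarith) |>.2
  have := pow_le_pow_left₀ (H2norm_nonneg V u w) h1 2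
  have := pow_le_pow_left₀ (H2norm_nonneg V u' w') h2 2
  nlinarith

lemma tail_bd {N : ℕ} (hN : 5 ≤ N) {V : ℝ → ℝ≥0∞} (hV : Measurable V) {K : ℝ → ℝ} {s : ℝ}
    (hK : HypK K s) {q : ℝ} (hq : 2 < q) (A : Set (E N)) (S : ℝ≥0∞)
    (hS : ∀ u w h z : E N → ℝ, MemH2Vr V u w → MemH2Vr V h z →
      ∫⁻ x in A, ENNReal.ofReal (K ‖x‖ * |u x| ^ (q-1) * |h x|) ≤
        ENNReal.ofReal (H2norm V u w ^ (q-1) * H2norm V h z) * S)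
    {f : ℝ → ℝ} {M : ℝ} (hM : 0 ≤ M) (hb : ∀ t, |f t| ≤ M * |t| ^ (q-1))
    {u w u' w' : E N → ℝ}
    (hu : MemH2Vr V u w) (hu' : MemH2Vr V u' w') {Λ : ℝ} (hΛ : 0 ≤ Λ) (h1 : H2norm V u w ≤ Λ)
    (h2 : H2norm V u' w' ≤ Λ) :
    ∫⁻ x in A, ‖K ‖x‖ * (f (u x) - f (u' x)) * (u x - u' x)‖ₑ ≤
      ENNReal.ofReal M * (2 * ENNReal.ofReal (Λ ^ (q-1) * (2 * Λ))) * S := by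
  have hh := hu.sub hN hV hu'
  have hhn := sub_norm_le hN hV hu hu' hΛ h1 h2
  have b1 := hS _ _ _ _ hu hh
  have b2 := hS _ _ _ _ hu' hh
  have hm : AEMeasurable (fun x => ENNReal.ofReal (K ‖x‖ * |u x| ^ (q-1) * |u x - u' x|))
      (volume.restrict A) := by
    have m1 := hu.1.1.1.1.aemeasurable.restrict (s := A)
    have m2 := hu'.1.1.1.1.aemeasurable.restrict (s := A)
    have m3 : Measurable (fun x : E N => K ‖x‖) := hK.2.1.comp measurable_norm
    exact ((m3.aemeasurable.mul (m1.abs.pow_const _)).mul (m1.sub m2).abs).ennreal_ofReal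
  have aux : ∀ X Y : ℝ, 0 ≤ X → X ≤ Λ → 0 ≤ Y → Y ≤ 2 * Λ →
      ENNReal.ofReal (X ^ (q-1) * Y) ≤ ENNReal.ofReal (Λ ^ (q-1) * (2 * Λ)) := by
    intro X Y hX hXL hY hYL
    gcongr
    linarith
  calc _ ≤ ∫⁻ x in A, ENNReal.ofReal M * (ENNReal.ofReal (K ‖x‖ * |u x| ^ (q-1) * |u x - u' x|)
        + ENNReal.ofReal (K ‖x‖ * |u' x| ^ (q-1) * |u x - u' x|)) := by
        refine lintegral_mono_ae ?_
        filter_upwards [ae_restrict_of_ae (ae_K_nonneg hN hK)] with x hx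
        rw [← ENNReal.ofReal_add (by positivity) (by positivity), ← ENNReal.ofReal_mul hM, ← ofReal_norm]
        apply ENNReal.ofReal_le_ofReal
        rw [Real.norm_eq_abs, abs_mul, abs_mul, abs_of_nonneg hx]
        have : |f (u x) - f (u' x)| ≤ M * |u x| ^ (q-1) + M * |u' x| ^ (q-1) :=
          (abs_sub _ _).trans (add_le_add (hb _) (hb _))
        calc _ ≤ K ‖x‖ * (M * |u x| ^ (q-1) + M * |u' x| ^ (q-1)) * |u x - u' x| := by gcongr
          _ = _ := by ring
    _ = ENNReal.ofReal M * ((∫⁻ x in A, ENNReal.ofReal (K ‖x‖ * |u x| ^ (q-1) * |u x - u' x|))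
        + ∫⁻ x in A, ENNReal.ofReal (K ‖x‖ * |u' x| ^ (q-1) * |u x - u' x|)) := by
        rw [lintegral_const_mul' _ _ ofReal_ne_top, lintegral_add_left' hm]
    _ ≤ ENNReal.ofReal M * (ENNReal.ofReal (Λ ^ (q-1) * (2 * Λ)) * S
        + ENNReal.ofReal (Λ ^ (q-1) * (2 * Λ)) * S) := by
        gcongr
        · exact b1.trans (mul_le_mul' (aux _ _ (H2norm_nonneg _ _ _) h1 (H2norm_nonneg _ _ _) hhn) le_rfl)
        · exact b2.trans (mul_le_mul' (aux _ _ (H2norm_nonneg _ _ _) h2 (H2norm_nonneg _ _ _) hhn) le_rfl)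
    _ = _ := by ring

lemma ann_small {N : ℕ} (hN : 5 ≤ N) {V : ℝ → ℝ≥0∞} {K : ℝ → ℝ} {s : ℝ}
    (hK : HypK K s) {q : ℝ} (hq : 2 < q) {f : ℝ → ℝ} {M : ℝ} (hM : 0 ≤ M)
    (hb : ∀ t, |f t| ≤ M * |t| ^ (q-1)) (u w : ℕ → E N → ℝ) (us : E N → ℝ)
    (hmem : ∀ n, MemH2Vr V (u n) (w n)) {Λ : ℝ}
    (hn : ∀ n, H2norm V (u n) (w n) ≤ Λ)
    (ht : ∀ᵐ x, Tendsto (fun n => u n x) atTop (𝓝 (us x))) {a b : ℝ} (ha : 0 < a) (hab : a < b)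
    {δ : ℝ≥0∞} (hδ : 0 < δ) :
    ∃ n0, ∀ n ≥ n0, ∀ m ≥ n0,
      ∫⁻ x in ann N a b, ‖K ‖x‖ * (f (u n x) - f (u m x)) * (u n x - u m x)‖ₑ < δ := by
  obtain ⟨C, hC⟩ := radial_bdd hN ha hab
  have hKn := ae_K_nonneg hN hK
  have m3 : Measurable (fun x : E N => K ‖x‖) := hK.2.1.comp measurable_norm
  have mus : AEMeasurable us volume :=
    aemeasurable_of_tendsto_metrizable_ae atTop (fun n => (hmem n).1.1.1.1.aemeasurable) ht
  set c : ℝ := (C * ENNReal.ofReal Λ).toReal with hc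
  have hcn : 0 ≤ c := toReal_nonneg
  have hcb : ∀ᵐ x, ∀ n, x ∈ ann N a b → |u n x| ≤ c := by
    rw [ae_all_iff]; intro n
    filter_upwards [hC _ _ (hmem n).1.1 (hmem n).2] with x hx hxA
    have h1 : ‖u n x‖ₑ ≤ C * ENNReal.ofReal Λ := (hx hxA.1 hxA.2).trans (by
      gcongr; exact (eLpNorm_w_le (hmem n)).trans (ENNReal.ofReal_le_ofReal (hn n)))
    have := ENNReal.toReal_mono (ENNReal.mul_ne_top coe_ne_top ofReal_ne_top) h1
    rw [toReal_enorm, Real.norm_eq_abs] at this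
    exact this
  have hd : Tendsto (fun n => ∫⁻ x in ann N a b, ENNReal.ofReal (K ‖x‖ * |u n x - us x|)) atTop (𝓝 0) := by
    have := tendsto_lintegral_of_dominated_convergence' (μ := volume.restrict (ann N a b))
      (F := fun n x => ENNReal.ofReal (K ‖x‖ * |u n x - us x|)) (f := fun _ => 0)
      (fun x => ENNReal.ofReal (2 * c) * ENNReal.ofReal (K ‖x‖))
      (fun n => ((m3.aemeasurable.mul ((hmem n).1.1.1.1.aemeasurable.sub mus).abs).ennreal_ofReal).restrict)
      (fun n => ?_) ?_ ?_
    · simpa using this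
    · rw [EventuallyLE, ae_restrict_iff' (ann_meas N a b)]
      filter_upwards [hcb, ht, hKn] with x hx hxt hK0 hxA
      have hus : |us x| ≤ c := le_of_tendsto' hxt.abs fun n => hx n hxA
      rw [← ENNReal.ofReal_mul (by positivity)]
      apply ENNReal.ofReal_le_ofReal
      rw [mul_comm]
      gcongr
      exact (abs_sub _ _).trans (by linarith [hx n hxA])
    · rw [lintegral_const_mul' _ _ ofReal_ne_top]
      exact ENNReal.mul_ne_top ofReal_ne_top (K_ann hN hK b ha).ne
    · filter_upwards [ae_restrict_of_ae ht] with x hx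
      have h1 : Tendsto (fun n => K ‖x‖ * |u n x - us x|) atTop (𝓝 0) := by
        have := ((hx.sub_const (us x)).abs).const_mul (K ‖x‖)
        simpa using this
      simpa using ENNReal.tendsto_ofReal h1
  set A : ℝ≥0∞ := ENNReal.ofReal (2 * M * c ^ (q-1)) with hA
  have hd2 := ENNReal.Tendsto.const_mul (a := A) hd (Or.inr ofReal_ne_top)
  rw [mul_zero] at hd2
  obtain ⟨n0, hn0⟩ := eventually_atTop.1 (hd2.eventually (gt_mem_nhds (ENNReal.half_pos hδ.ne')))
  refine ⟨n0, fun n hnn m hmm => ?_⟩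
  refine lt_of_le_of_lt ?_ ((ENNReal.add_lt_add (hn0 n hnn) (hn0 m hmm)).trans_le
    (ENNReal.add_halves δ).le)
  have hmm1 : AEMeasurable (fun x => ENNReal.ofReal (K ‖x‖ * |u n x - us x|))
      (volume.restrict (ann N a b)) :=
    ((m3.aemeasurable.mul ((hmem n).1.1.1.1.aemeasurable.sub mus).abs).ennreal_ofReal).restrict
  rw [← mul_add, ← lintegral_add_left' hmm1, ← lintegral_const_mul' _ _ ofReal_ne_top]
  refine lintegral_mono_ae ?_
  rw [ae_restrict_iff' (ann_meas N a b)]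
  filter_upwards [hcb, hKn] with x hx hK0 hxA
  rw [← ENNReal.ofReal_add (by positivity) (by positivity), ← ENNReal.ofReal_mul (by positivity),
    ← ofReal_norm]
  apply ENNReal.ofReal_le_ofReal
  rw [Real.norm_eq_abs, abs_mul, abs_mul, abs_of_nonneg hK0]
  have hf1 : ∀ k, |f (u k x)| ≤ M * c ^ (q-1) := fun k => (hb _).trans (by
    have := Real.rpow_le_rpow (abs_nonneg _) (hx k hxA) (by linarith : 0 ≤ q-1)
    gcongr)
  have h1 : |f (u n x) - f (u m x)| ≤ 2 * M * c ^ (q-1) :=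
    (abs_sub _ _).trans (by linarith [hf1 n, hf1 m])
  have h2 : |u n x - u m x| ≤ |u n x - us x| + |u m x - us x| := by
    have := abs_sub (u n x - us x) (u m x - us x)
    rwa [sub_sub_sub_cancel_right] at this
  calc _ ≤ K ‖x‖ * (2 * M * c ^ (q-1)) * (|u n x - us x| + |u m x - us x|) := by gcongr
    _ = _ := by ring

lemma T_small {N : ℕ} (hN : 5 ≤ N) {V : ℝ → ℝ≥0∞} (hV : Measurable V) {K : ℝ → ℝ} {s : ℝ}
    (hK : HypK K s) {q1 q2 : ℝ} (hq1 : 2 < q1) (hq2 : 2 < q2) (hR : Rcond N V K q1 q2)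
    {f : ℝ → ℝ} (hfneg : ∀ t : ℝ, t < 0 → f t = 0) (hfg : Hypf f q1 q2)
    (u w : ℕ → E N → ℝ) (us : E N → ℝ)
    (hmem : ∀ n, MemH2Vr V (u n) (w n)) {Λ : ℝ} (hΛ : 0 ≤ Λ)
    (hn : ∀ n, H2norm V (u n) (w n) ≤ Λ)
    (ht : ∀ᵐ x, Tendsto (fun n => u n x) atTop (𝓝 (us x))) {δ : ℝ≥0∞} (hδ : 0 < δ) :
    ∃ n0, ∀ n ≥ n0, ∀ m ≥ n0,
      ∫⁻ x, ‖K ‖x‖ * (f (u n x) - f (u m x)) * (u n x - u m x)‖ₑ ≤ δ := by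
  obtain ⟨M, hM, hb⟩ := hfg
  have hb := f_bd hM hfneg hb
  have hb1 : ∀ t, |f t| ≤ M * |t| ^ (q1-1) := fun t => (hb t).trans (by gcongr; exact min_le_left _ _)
  have hb2 : ∀ t, |f t| ≤ M * |t| ^ (q2-1) := fun t => (hb t).trans (by gcongr; exact min_le_right _ _)
  have hcc : ∀ q : ℝ, ENNReal.ofReal M * (2 * ENNReal.ofReal (Λ ^ (q-1) * (2 * Λ))) ≠ ⊤ := fun q =>
    ENNReal.mul_ne_top ofReal_ne_top (ENNReal.mul_ne_top (by norm_num) ofReal_ne_top)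
  have l1 := ENNReal.Tendsto.const_mul hR.1 (Or.inr (hcc q1))
  have l2 := ENNReal.Tendsto.const_mul hR.2 (Or.inr (hcc q2))
  rw [mul_zero] at l1 l2
  have hδ3 : 0 < δ / 3 := ENNReal.div_pos hδ.ne' (by norm_num)
  obtain ⟨R, hR0, hRp⟩ := ((l1.eventually (gt_mem_nhds hδ3)).and self_mem_nhdsWithin).exists
  have hRp : 0 < R := hRp
  obtain ⟨R', hR', hRR⟩ := ((l2.eventually (gt_mem_nhds hδ3)).and (eventually_gt_atTop R)).exists
  obtain ⟨n0, hn0⟩ := ann_small hN hK hq1 hM.le hb1 u w us hmem hn ht (half_pos hRp)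
    (by linarith : R/2 < R') hδ3
  refine ⟨n0, fun n hnn m hmm => (split3 _ (R' := R') hRp).trans ?_⟩
  have t1 := (tail_bd hN hV hK hq1 (Metric.ball 0 R) (R0 N V K q1 R)
    (fun u w h z a b => R0_bd hN hV hq1 R a b) hM.le hb1 (hmem n) (hmem m) hΛ (hn n) (hn m)).trans hR0.le
  have t2 := (tail_bd hN hV hK hq2 (Metric.ball 0 R')ᶜ (Rinf N V K q2 R')
    (fun u w h z a b => Rinf_bd hN hV hq2 R' a b) hM.le hb2 (hmem n) (hmem m) hΛ (hn n) (hn m)).trans hR'.le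
  exact (add_le_add (add_le_add t1 t2) (hn0 n hnn m hmm).le).trans (ENNReal.add_thirds δ).le

lemma PS_cauchy {N : ℕ} (hN : 5 ≤ N) {V : ℝ → ℝ≥0∞} (hV : Measurable V) {K : ℝ → ℝ} {s : ℝ}
    (hK : HypK K s) {q1 q2 : ℝ} (hq1 : 2 < q1) (hq2 : 2 < q2) (hR : Rcond N V K q1 q2)
    {f : ℝ → ℝ} (hf : Continuous f) (hfneg : ∀ t : ℝ, t < 0 → f t = 0) (hfg : Hypf f q1 q2)
    (u w : ℕ → E N → ℝ) (us : E N → ℝ)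
    (hmem : ∀ n, MemH2Vr V (u n) (w n)) {Λ : ℝ} (hΛ : 0 ≤ Λ)
    (hn : ∀ n, H2norm V (u n) (w n) ≤ Λ)
    (ht : ∀ᵐ x, Tendsto (fun n => u n x) atTop (𝓝 (us x)))
    (hderiv : ∀ ε > (0:ℝ), ∃ n0 : ℕ, ∀ n ≥ n0, ∀ h z : E N → ℝ, MemH2Vr V h z →
      |bil V (u n) (w n) h z - ∫ x, K ‖x‖ * f (u n x) * h x| ≤ ε * H2norm V h z)
    {ε : ℝ} (hε : 0 < ε) :
    ∃ n0, ∀ n ≥ n0, ∀ m ≥ n0,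
      H2norm V (fun x => u n x - u m x) (fun x => w n x - w m x) ≤ ε := by
  have hε' : 0 < ε^2 / (8 * Λ + 1) := by positivity
  obtain ⟨n1, h1⟩ := hderiv _ hε'
  obtain ⟨n2, h2⟩ := T_small hN hV hK hq1 hq2 hR hfneg hfg u w us hmem hΛ hn ht
    (ENNReal.ofReal_pos.2 (by positivity : 0 < ε^2/2))
  refine ⟨max n1 n2, fun n hnn m hmm => ?_⟩
  have hh := (hmem n).sub hN hV (hmem m)
  have hhn := sub_norm_le hN hV (hmem n) (hmem m) hΛ (hn n) (hn m)
  have a1 := h1 n ((le_max_left _ _).trans hnn) _ _ hh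
  have a2 := h1 m ((le_max_left _ _).trans hmm) _ _ hh
  have a3 := h2 n ((le_max_right _ _).trans hnn) m ((le_max_right _ _).trans hmm)
  have a4 := (enorm_integral_le_lintegral_enorm _).trans a3
  have e : (∫ x, K ‖x‖ * (f (u n x) - f (u m x)) * (u n x - u m x)) =
      (∫ x, K ‖x‖ * f (u n x) * (u n x - u m x)) - ∫ x, K ‖x‖ * f (u m x) * (u n x - u m x) := by
    rw [← integral_sub (Kfh_int hN hV hK hq1 hq2 hR hf hfneg hfg (hmem n) hh)
      (Kfh_int hN hV hK hq1 hq2 hR hf hfneg hfg (hmem m) hh)]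
    congr 1; funext x; ring
  rw [e, ← ofReal_norm, ENNReal.ofReal_le_ofReal_iff (by positivity), Real.norm_eq_abs] at a4
  have a5 := bil_sub hN hV (hmem n) (hmem m) hh
  rw [← norm_sq_bil hV hh] at a5
  set X := H2norm V (fun x => u n x - u m x) (fun x => w n x - w m x)
  have hX : 0 ≤ X := H2norm_nonneg _ _ _
  have a6 : ε^2 / (8 * Λ + 1) * X ≤ ε^2/4 := by
    rw [div_mul_eq_mul_div, div_le_iff₀ (by positivity)]
    nlinarith [sq_nonneg ε]
  rw [abs_le] at a1 a2 a4
  refine abs_le_of_sq_le_sq' ?_ hε.le |>.2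
  linarith

open MeasureTheory Filter Topology Set ENNReal

lemma exists_ofReal_le {δ : ℝ≥0∞} (hδ : 0 < δ) : ∃ ε : ℝ, 0 < ε ∧ ENNReal.ofReal ε ≤ δ := by
  obtain ⟨r, hr0, hr1⟩ := ENNReal.lt_iff_exists_nnreal_btwn.1 hδ
  exact ⟨r, by exact_mod_cast hr0, by simpa using hr1.le⟩

lemma L2_lim {N : ℕ} (w : ℕ → E N → ℝ) (hw : ∀ n, MemLp (w n) 2 volume)
    (hc : ∀ ε > (0:ℝ), ∃ n0, ∀ n ≥ n0, ∀ m ≥ n0,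
      eLpNorm (fun x => w n x - w m x) 2 volume ≤ ENNReal.ofReal ε) :
    ∃ w' : E N → ℝ, MemLp w' 2 volume ∧
      Tendsto (fun n => eLpNorm (fun x => w n x - w' x) 2 volume) atTop (𝓝 0) := by
  have hcs : CauchySeq (fun n => (hw n).toLp (w n)) := by
    rw [EMetric.cauchySeq_iff]
    intro δ hδ
    obtain ⟨ε, hε, hεδ⟩ := exists_ofReal_le (ENNReal.half_pos hδ.ne')
    by_cases htop : δ = ⊤
    · refine ⟨0, fun n _ m _ => ?_⟩
      rw [Lp.edist_toLp_toLp, htop]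
      exact ((hw n).sub (hw m)).2
    obtain ⟨n0, h0⟩ := hc ε hε
    refine ⟨n0, fun n hn m hm => ?_⟩
    rw [Lp.edist_toLp_toLp]
    exact ((h0 n hn m hm).trans hεδ).trans_lt (ENNReal.half_lt_self hδ.ne' htop)
  obtain ⟨g, hg⟩ := cauchySeq_tendsto_of_complete hcs
  refine ⟨g, Lp.memLp g, ?_⟩
  have := (Lp.tendsto_Lp_iff_tendsto_eLpNorm'' w hw g (Lp.memLp g)).1 (by simpa using hg)
  exact this

lemma PS_complete {N : ℕ} (hN : 5 ≤ N) {V : ℝ → ℝ≥0∞} (hV : Measurable V)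
    (u w : ℕ → E N → ℝ) (us : E N → ℝ) (hrad : IsRadial us)
    (hmem : ∀ n, MemH2Vr V (u n) (w n))
    (ht : ∀ᵐ x, Tendsto (fun n => u n x) atTop (𝓝 (us x)))
    (hc : ∀ ε > (0:ℝ), ∃ n0, ∀ n ≥ n0, ∀ m ≥ n0,
      H2norm V (fun x => u n x - u m x) (fun x => w n x - w m x) ≤ ε) :
    ∃ w' : E N → ℝ, MemH2Vr V us w' ∧
      Tendsto (fun k => H2norm V (fun x => u k x - us x) (fun x => w k x - w' x)) atTop (𝓝 0) := by
  obtain ⟨C, hC⟩ := sobolev_D22 hN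
  have hsub := fun n m => (hmem n).sub hN hV (hmem m)
  have mu := fun n => (hmem n).1.1.1.1
  have mus : AEStronglyMeasurable us volume := aestronglyMeasurable_of_tendsto_ae atTop mu ht
  obtain ⟨w', hw'm, hw'⟩ := L2_lim w (fun n => (hmem n).1.1.2.1) (fun ε hε => by
    obtain ⟨n0, h0⟩ := hc ε hε
    exact ⟨n0, fun n hn m hm => (eLpNorm_w_le (hsub n m)).trans
      (ENNReal.ofReal_le_ofReal (h0 n hn m hm))⟩)
  have hp : Tendsto (fun n => eLpNorm (fun x => u n x - us x) (twoSS N) volume) atTop (𝓝 0) := by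
    rw [ENNReal.tendsto_nhds_zero]
    intro δ hδ
    obtain ⟨ε, hε, hεδ⟩ := exists_ofReal_le (ENNReal.div_pos hδ.ne' (coe_ne_top (r := C)))
    obtain ⟨n0, h0⟩ := hc ε hε
    filter_upwards [eventually_ge_atTop n0] with n hn
    have h1 := Lp.eLpNorm_lim_le_liminf_eLpNorm (p := twoSS N) (μ := volume)
      (f := fun m x => u n x - u m x)
      (fun m => (mu n).sub (mu m)) (fun x => u n x - us x) (by
        filter_upwards [ht] with x hx using hx.const_sub _)
    refine h1.trans (liminf_le_of_frequently_le' (Eventually.frequently ?_))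
    filter_upwards [eventually_ge_atTop n0] with m hm
    calc _ ≤ C * eLpNorm (fun x => w n x - w m x) 2 volume := hC _ _ (hsub n m).1.1
      _ ≤ C * (δ / C) := by
        gcongr
        exact (eLpNorm_w_le (hsub n m)).trans ((ENNReal.ofReal_le_ofReal (h0 n hn m hm)).trans hεδ)
      _ ≤ δ := ENNReal.mul_div_le
  have hv : Tendsto (fun n => ∫⁻ x : E N, V ‖x‖ * ENNReal.ofReal ((u n x - us x)^2)) atTop (𝓝 0) := by
    rw [ENNReal.tendsto_nhds_zero]
    intro δ hδ
    obtain ⟨ε, hε, hεδ⟩ := exists_ofReal_le hδ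
    obtain ⟨n0, h0⟩ := hc (√ε) (Real.sqrt_pos.2 hε)
    filter_upwards [eventually_ge_atTop n0] with n hn
    have hfm : ∀ m, AEMeasurable (fun x : E N => V ‖x‖ * ENNReal.ofReal ((u n x - u m x)^2)) volume :=
      fun m => (hV.comp measurable_norm).aemeasurable.mul
        (((mu n).sub (mu m)).aemeasurable.pow_const 2).ennreal_ofReal
    calc _ ≤ ∫⁻ x : E N, liminf (fun m => V ‖x‖ * ENNReal.ofReal ((u n x - u m x)^2)) atTop := by
          refine lintegral_mono_ae ?_
          filter_upwards [ht] with x hx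
          have h1 := ENNReal.tendsto_ofReal ((hx.const_sub (u n x)).pow 2)
          by_cases hz : ENNReal.ofReal ((u n x - us x)^2) = 0
          · rw [hz, mul_zero]; exact zero_le
          · exact (ENNReal.Tendsto.const_mul h1 (Or.inl hz)).liminf_eq.ge
      _ ≤ liminf (fun m => ∫⁻ x : E N, V ‖x‖ * ENNReal.ofReal ((u n x - u m x)^2)) atTop :=
          lintegral_liminf_le' hfm
      _ ≤ δ := by
          refine liminf_le_of_frequently_le' (Eventually.frequently ?_)
          filter_upwards [eventually_ge_atTop n0] with m hm
          have h1 : (∫⁻ x : E N, V ‖x‖ * ENNReal.ofReal ((u n x - u m x)^2)) ≤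
              QQ V (fun x => u n x - u m x) (fun x => w n x - w m x) := le_add_self
          refine h1.trans (le_trans ?_ hεδ)
          rw [← ENNReal.ofReal_toReal (QQ_lt_top (hsub n m)).ne, ← H2norm_sq]
          apply ENNReal.ofReal_le_ofReal
          have := pow_le_pow_left₀ (H2norm_nonneg _ _ _) (h0 n hn m hm) 2
          rwa [Real.sq_sqrt hε.le] at this
  have husm : MemLp us (twoSS N) volume := by
    obtain ⟨n, hn⟩ := (hp.eventually (gt_mem_nhds zero_lt_one)).exists
    have h1 : MemLp (fun x => u n x - us x) (twoSS N) volume := ⟨(mu n).sub mus, hn.trans one_lt_top⟩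
    have := (hmem n).1.1.1.sub h1
    have e : (u n - fun x => u n x - us x) = us := by funext x; simp
    rwa [e] at this
  have hD : MemD22 N us w' := by
    refine ⟨husm, hw'm, ?_⟩
    have hex : ∀ n : ℕ, ∃ φ : E N → ℝ, (ContDiff ℝ (⊤ : ℕ∞) φ ∧ HasCompactSupport φ) ∧
        eLpNorm (fun x => φ x - u n x) (twoSS N) volume ≤ ((n:ℝ≥0∞)+1)⁻¹ ∧
        eLpNorm (fun x => lapl φ x - w n x) 2 volume ≤ ((n:ℝ≥0∞)+1)⁻¹ := by
      intro n
      obtain ⟨-, -, φ, hφ, h1, h2⟩ := (hmem n).1.1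
      have hpos : (0:ℝ≥0∞) < ((n:ℝ≥0∞)+1)⁻¹ := by
        rw [ENNReal.inv_pos]
        exact ENNReal.add_ne_top.2 ⟨ENNReal.natCast_ne_top n, one_ne_top⟩
      obtain ⟨k, h3, h4⟩ := ((h1.eventually (gt_mem_nhds hpos)).and (h2.eventually (gt_mem_nhds hpos))).exists
      exact ⟨φ k, hφ k, h3.le, h4.le⟩
    choose φ hφ h1 h2 using hex
    have hinv : Tendsto (fun n : ℕ => ((n:ℝ≥0∞)+1)⁻¹) atTop (𝓝 0) := by
      have := (tendsto_add_atTop_iff_nat (f := fun n : ℕ => ((n:ℝ≥0∞))⁻¹) 1).2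
        ENNReal.tendsto_inv_nat_nhds_zero
      simpa using this
    refine ⟨φ, hφ, ?_, ?_⟩
    · have hl := hinv.add hp
      rw [add_zero] at hl
      refine tendsto_of_tendsto_of_tendsto_of_le_of_le tendsto_const_nhds hl (fun n => zero_le) fun n => ?_
      have e : (fun x => φ n x - us x) = (fun x => φ n x - u n x) + (fun x => u n x - us x) := by
        funext x; simp
      simp only [e]
      refine (eLpNorm_add_le ((hφ n).1.continuous.aestronglyMeasurable.sub (mu n)) ((mu n).sub mus)
        (one_le_twoSS hN)).trans ?_
      exact add_le_add (h1 n) le_rfl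
    · have hl := hinv.add hw'
      rw [add_zero] at hl
      refine tendsto_of_tendsto_of_tendsto_of_le_of_le tendsto_const_nhds hl (fun n => zero_le) fun n => ?_
      have e : (fun x => lapl (φ n) x - w' x) = (fun x => lapl (φ n) x - w n x) + (fun x => w n x - w' x) := by
        funext x; simp
      simp only [e]
      refine (eLpNorm_add_le ((lapl_contDiff (hφ n).1).continuous.aestronglyMeasurable.sub
        (hmem n).1.1.2.1.1) ((hmem n).1.1.2.1.1.sub hw'm.1) (by norm_num)).trans ?_
      exact add_le_add (h2 n) le_rfl
  have hVf : (∫⁻ x : E N, V ‖x‖ * ENNReal.ofReal ((us x) ^ 2)) < ⊤ := by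
    obtain ⟨n, hn⟩ := (hv.eventually (gt_mem_nhds zero_lt_one)).exists
    have hm1 : AEMeasurable (fun x : E N => V ‖x‖ * ENNReal.ofReal ((u n x)^2)) volume :=
      (hV.comp measurable_norm).aemeasurable.mul ((mu n).aemeasurable.pow_const 2).ennreal_ofReal
    calc _ ≤ ∫⁻ x : E N, 2 * (V ‖x‖ * ENNReal.ofReal ((u n x)^2) +
          V ‖x‖ * ENNReal.ofReal ((u n x - us x)^2)) := by
          refine lintegral_mono fun x => ?_
          rw [← mul_add, mul_left_comm, ← ENNReal.ofReal_add (sq_nonneg _) (sq_nonneg _)]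
          gcongr
          have : (2:ℝ≥0∞) = ENNReal.ofReal 2 := by simp
          rw [this, ← ENNReal.ofReal_mul (by norm_num)]
          apply ENNReal.ofReal_le_ofReal
          nlinarith [sq_nonneg (2 * u n x - us x)]
      _ < ⊤ := by
          rw [lintegral_const_mul' _ _ (by norm_num), lintegral_add_left' hm1]
          exact ENNReal.mul_lt_top (by norm_num) (ENNReal.add_lt_top.2 ⟨(hmem n).1.2, hn.trans one_lt_top⟩)
  refine ⟨w', ⟨⟨hD, hVf⟩, hrad⟩, ?_⟩
  have hQ : Tendsto (fun k => QQ V (fun x => u k x - us x) (fun x => w k x - w' x)) atTop (𝓝 0) := by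
    have h1 := (ENNReal.Tendsto.pow (n := 2) hw').add hv
    simp only [ne_eq, OfNat.ofNat_ne_zero, not_false_eq_true, zero_pow, add_zero] at h1
    refine h1.congr fun k => ?_
    unfold QQ
    rw [lint_sq]
  have h2 := ((ENNReal.tendsto_toReal (zero_ne_top)).comp hQ).sqrt
  simp only [ENNReal.toReal_zero, Real.sqrt_zero] at h2
  refine h2.congr fun k => ?_
  rw [H2norm_eq]
  rfl

/-- Lemma 7.3, Palais–Smale: under the hypotheses of Theorem 6.1 (with
`Q = 0` and `f` vanishing on the negative half-line), the functional
`I(u) = ½‖u‖² - ∫ K(|x|)F(u) dx` satisfies the Palais–Smale condition on `H²_{V,r}`: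
every sequence with `I(u_n)` bounded and `I'(u_n) → 0` in the dual of `H²_{V,r}` has a
subsequence converging strongly in `H²_{V,r}`. -/
theorem stmt19 (N : ℕ) (hN : 5 ≤ N) (V : ℝ → ℝ≥0∞) (K : ℝ → ℝ) (s : ℝ)
    (hV : HypV V) (hK : HypK K s) (hs : 2*(N:ℝ)/(N+4) < s)
    (f : ℝ → ℝ) (hf : Continuous f) (hf0 : f 0 = 0) (hfneg : ∀ t : ℝ, t < 0 → f t = 0)
    (q1 q2 : ℝ) (hq1 : 2 < q1) (hq2 : 2 < q2)
    (hfg : Hypf f q1 q2) (hR : Rcond N V K q1 q2)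
    (hcase :
      ((∃ θ > (2:ℝ), ∀ t : ℝ, 0 ≤ t → 0 ≤ θ * Fint f t ∧ θ * Fint f t ≤ f t * t) ∧
        ∃ t0 > (0:ℝ), 0 < Fint f t0) ∨
      (Integrable (fun x : E N => K ‖x‖) ∧
        ∃ θ > (2:ℝ), ∃ t0 > (0:ℝ), ∀ t : ℝ, t0 ≤ t →
          0 < θ * Fint f t ∧ θ * Fint f t ≤ f t * t))
    (u w : ℕ → E N → ℝ) (hmem : ∀ n, MemH2Vr V (u n) (w n))
    (hbdd : ∃ B : ℝ, ∀ n, |EulerI N V K (fun _ => 0) f (u n) (w n)| ≤ B)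
    (hderiv : ∀ ε > (0:ℝ), ∃ n0 : ℕ, ∀ n ≥ n0, ∀ h z : E N → ℝ, MemH2Vr V h z →
      |(∫ x, w n x * z x) + (∫ x, (V ‖x‖).toReal * u n x * h x) -
        ∫ x, K ‖x‖ * f (u n x) * h x| ≤ ε * H2norm V h z) :
    ∃ ψ : ℕ → ℕ, StrictMono ψ ∧ ∃ u' w' : E N → ℝ, MemH2Vr V u' w' ∧
      Tendsto (fun k => H2norm V (fun x => u (ψ k) x - u' x) (fun x => w (ψ k) x - w' x))
        atTop (𝓝 0) := by
  obtain ⟨Λ, n0, hΛ, hn0⟩ := PS_bdd hN hV.1 hK hq1 hq2 hR hf hf0 hfneg hfg hcase u w hmem hbdd hderiv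
  obtain ⟨ψ, hψ, hae⟩ := compact_ae hN (fun n => u (n + n0)) (fun n => w (n + n0))
    (fun n => (hmem _).1.1) (fun n => (hmem _).2) (ENNReal.ofReal Λ) ofReal_ne_top
    (fun n => (eLpNorm_w_le (hmem _)).trans (ENNReal.ofReal_le_ofReal (hn0 _ (Nat.le_add_left _ _))))
  set σ : ℕ → ℕ := fun k => ψ k + n0 with hσdef
  have hσ : StrictMono σ := fun a b hab => Nat.add_lt_add_right (hψ hab) n0
  set us : E N → ℝ := fun x => limUnder atTop (fun k => u (σ k) x) with hus
  have hrad : IsRadial us := by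
    intro x y hxy
    have e : (fun k => u (σ k) x) = fun k => u (σ k) y := by
      funext k
      exact (hmem _).2 x y hxy
    rw [hus]
    simp only [e]
  have ht : ∀ᵐ x, Tendsto (fun k => u (σ k) x) atTop (𝓝 (us x)) := by
    filter_upwards [hae] with x hx
    exact tendsto_nhds_limUnder hx
  have hd : ∀ ε > (0:ℝ), ∃ n0 : ℕ, ∀ n ≥ n0, ∀ h z : E N → ℝ, MemH2Vr V h z →
      |bil V (u (σ n)) (w (σ n)) h z - ∫ x, K ‖x‖ * f (u (σ n) x) * h x| ≤ ε * H2norm V h z := by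
    intro ε hε
    obtain ⟨m0, hm0⟩ := hderiv ε hε
    exact ⟨m0, fun n hn => hm0 (σ n) (hn.trans (hσ.id_le n))⟩
  obtain ⟨w', hm', hlim⟩ := PS_complete hN hV.1 (fun k => u (σ k)) (fun k => w (σ k)) us hrad
    (fun n => hmem _) ht (fun ε hε => PS_cauchy hN hV.1 hK hq1 hq2 hR hf hfneg hfg
      (fun k => u (σ k)) (fun k => w (σ k)) us (fun n => hmem _) hΛ
      (fun n => hn0 _ (Nat.le_add_left _ _)) ht hd hε)
  exact ⟨σ, hσ, us, w', hm', hlim⟩
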